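/- arXiv:2004.04553 — 3 statements merged into one kernel-verified Lean document; each statement's English description precedes it below -/
import Mathlib

section
/- Let d ≥ 1 and p > q > d/2. There exists ε₀ > 0 such that for every ε ∈ [0, ε₀) and every a ∈ (0,∞)^d with a₁⋯a_d = 1 and a ≠ (1,…,1), one has Σ_{n∈ℤ^d∖{0}} Q_a(n)^{−p} + ε Σ_{n∈ℤ^d∖{0}} (−1)^{n₁+⋯+n_d} Q_a(n)^{−q} > Σ_{n∈ℤ^d∖{0}} (n₁²+⋯+n_d²)^{−p} + ε Σ_{n∈ℤ^d∖{0}} (−1)^{n₁+⋯+n_d} (n₁²+⋯+n_d²)^{−q}; that is, the cubic lattice is the unique minimizer of the perturbed energy among orthorhombic lattices of unit covolume for all sufficiently small ε ≥ 0. -/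
noncomputable section

/-- Quadratic form of the orthorhombic lattice `L_a = a₁ℤ × ⋯ × a_dℤ`:
`Q_a(n) = a₁²n₁² + ⋯ + a_d²n_d²`. -/
def Qf (d : ℕ) (a : Fin d → ℝ) (n : Fin d → ℤ) : ℝ :=
  ∑ i, (a i) ^ 2 * (n i : ℝ) ^ 2

/-- The alternating charge distribution `φ_±(n) = (-1)^{n₁+⋯+n_d}`. -/
def altSign (d : ℕ) (n : Fin d → ℤ) : ℝ := (-1 : ℝ) ^ (∑ i, n i)

/-- The moments `∑ₙ (π n²)ᵏ exp (-π n² s)` of the theta series. -/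
def thetaMoment (k : ℕ) (s : ℝ) : ℝ :=
  ∑' n : ℤ, (Real.pi * (n : ℝ) ^ 2) ^ k * Real.exp (-(Real.pi * (n : ℝ) ^ 2 * s))

lemma summable_thetaMoment (k : ℕ) {s : ℝ} (hs : 0 < s) :
    Summable fun n : ℤ =>
      (Real.pi * (n : ℝ) ^ 2) ^ k * Real.exp (-(Real.pi * (n : ℝ) ^ 2 * s)) := by
  refine ((summable_pow_mul_jacobiTheta₂_term_bound 0 hs (2 * k)).mul_left (Real.pi ^ k)).congr ?_
  intro n
  rw [mul_pow, Int.cast_abs, pow_mul, sq_abs]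
  ring_nf

lemma hasDerivAt_thetaMoment (k : ℕ) {s : ℝ} (hs : 0 < s) :
    HasDerivAt (thetaMoment k) (-thetaMoment (k + 1) s) s := by
  have hs2 : 0 < s / 2 := half_pos hs
  have key := hasDerivAt_tsum_of_isPreconnected
    (u := fun n : ℤ => (Real.pi * (n : ℝ) ^ 2) ^ (k + 1)
      * Real.exp (-(Real.pi * (n : ℝ) ^ 2 * (s / 2))))
    (g := fun (n : ℤ) (x : ℝ) => (Real.pi * (n : ℝ) ^ 2) ^ k
      * Real.exp (-(Real.pi * (n : ℝ) ^ 2 * x)))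
    (g' := fun (n : ℤ) (x : ℝ) => -((Real.pi * (n : ℝ) ^ 2) ^ (k + 1)
      * Real.exp (-(Real.pi * (n : ℝ) ^ 2 * x))))
    (t := Set.Ioi (s / 2)) (y₀ := s) (y := s)
    (summable_thetaMoment (k + 1) hs2) isOpen_Ioi isPreconnected_Ioi ?_ ?_
    (Set.mem_Ioi.2 (by linarith)) (summable_thetaMoment k hs) (Set.mem_Ioi.2 (by linarith))
  · rw [tsum_neg] at key
    exact key
  · intro n x _
    have h := ((((hasDerivAt_id x).const_mul (Real.pi * (n : ℝ) ^ 2)).neg).exp).const_mul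
      ((Real.pi * (n : ℝ) ^ 2) ^ k)
    convert! h using 1
    simp only [id, Pi.neg_apply]
    ring
  · intro n x hx
    rw [norm_neg, Real.norm_of_nonneg (by positivity)]
    have := (Set.mem_Ioi.1 hx).le
    gcongr

lemma thetaMoment_nonneg (k : ℕ) (s : ℝ) : 0 ≤ thetaMoment k s :=
  tsum_nonneg fun _ => by positivity

lemma one_le_thetaMoment_zero {s : ℝ} (hs : 0 < s) : 1 ≤ thetaMoment 0 s := by
  have := (summable_thetaMoment 0 hs).le_tsum 0 (fun n _ => by positivity)
  simpa [thetaMoment] using this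

lemma thetaMoment_antitone (k : ℕ) {s t : ℝ} (hs : 0 < s) (hst : s ≤ t) :
    thetaMoment k t ≤ thetaMoment k s := by
  refine (summable_thetaMoment k (hs.trans_le hst)).tsum_le_tsum (fun n => ?_)
    (summable_thetaMoment k hs)
  gcongr

lemma thetaMoment_one_pos {s : ℝ} (hs : 0 < s) : 0 < thetaMoment 1 s :=
  (summable_thetaMoment 1 hs).tsum_pos (fun n => by positivity) 1 (by simp; positivity)

/-- The Jacobi identity for the theta series. -/
lemma thetaMoment_zero_inv {s : ℝ} (hs : 0 < s) :
    thetaMoment 0 s = s ^ (-(1 / 2) : ℝ) * thetaMoment 0 s⁻¹ := by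
  have h := Real.tsum_exp_neg_mul_int_sq hs
  rw [one_div, ← Real.rpow_neg hs.le] at h
  simp only [thetaMoment, pow_zero, one_mul]
  convert h using 4 <;> field_simp

lemma one_le_sq_cast {n : ℤ} (hn : n ≠ 0) : (1 : ℝ) ≤ (n : ℝ) ^ 2 := by
  exact_mod_cast Int.one_le_abs (pow_ne_zero 2 hn) |>.trans_eq (abs_of_nonneg (sq_nonneg n))

lemma pi_mul_thetaMoment_one_le {s : ℝ} (hs : 0 < s) :
    Real.pi * thetaMoment 1 s ≤ thetaMoment 2 s := by
  rw [thetaMoment, ← tsum_mul_left]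
  refine ((summable_thetaMoment 1 hs).mul_left _).tsum_le_tsum (fun n => ?_)
    (summable_thetaMoment 2 hs)
  rw [← mul_assoc]
  gcongr
  rcases eq_or_ne n 0 with rfl | hn
  · simp
  have h1 : (1 : ℝ) ≤ (n : ℝ) ^ 2 := one_le_sq_cast hn
  have := Real.pi_pos
  rw [pow_one, pow_two (Real.pi * _)]
  gcongr
  nlinarith

lemma pi_mul_thetaMoment_zero_sub_one_le {s : ℝ} (hs : 0 < s) :
    Real.pi * (thetaMoment 0 s - 1) ≤ thetaMoment 1 s := by
  have h0 := (summable_thetaMoment 0 hs).hasSum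
  have h1 := ((summable_thetaMoment 1 hs).hasSum.sub (h0.mul_left Real.pi))
  have h2 := (h1.add (hasSum_ite_eq (0 : ℤ) Real.pi)).nonneg (fun n => ?_)
  · simp only [thetaMoment] at *
    linarith
  · rcases eq_or_ne n 0 with rfl | hn
    · simp
    have h1 : (1 : ℝ) ≤ (n : ℝ) ^ 2 := one_le_sq_cast hn
    have := Real.pi_pos
    have he := Real.exp_pos (-(Real.pi * (n : ℝ) ^ 2 * s))
    simp only [hn, if_false, pow_one, pow_zero, one_mul, add_zero, sub_nonneg]
    gcongr
    nlinarith

lemma sq_thetaMoment_one_le {s : ℝ} (hs : 0 < s) :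
    thetaMoment 1 s ^ 2 ≤ (thetaMoment 0 s - 1) * thetaMoment 2 s := by
  have h (x : ℝ) : 0 ≤ (thetaMoment 0 s - 1) * (x * x) + 2 * thetaMoment 1 s * x
      + thetaMoment 2 s := by
    have hsum := (((summable_thetaMoment 0 hs).hasSum.mul_left (x ^ 2)).add
      ((summable_thetaMoment 1 hs).hasSum.mul_left (2 * x))).add
      (summable_thetaMoment 2 hs).hasSum
    have := hsum.summable.le_tsum 0 (fun n _ => ?_)
    · rw [hsum.tsum_eq] at this
      simp only [Int.cast_zero] at this
      norm_num at this
      simp only [thetaMoment] at *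
      simp only [pow_zero, pow_one, one_mul] at *
      linarith
    · have e : x ^ 2 * ((Real.pi * (n : ℝ) ^ 2) ^ 0 * Real.exp (-(Real.pi * (n : ℝ) ^ 2 * s)))
          + 2 * x * ((Real.pi * (n : ℝ) ^ 2) ^ 1 * Real.exp (-(Real.pi * (n : ℝ) ^ 2 * s)))
          + (Real.pi * (n : ℝ) ^ 2) ^ 2 * Real.exp (-(Real.pi * (n : ℝ) ^ 2 * s))
          = (x + Real.pi * (n : ℝ) ^ 2) ^ 2 * Real.exp (-(Real.pi * (n : ℝ) ^ 2 * s)) := by ring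
      rw [e]
      positivity
  have := discrim_le_zero h
  rw [discrim] at this
  linarith

/-- `log θ (eˣ)`, where `θ` is the theta series. -/
def logTheta (x : ℝ) : ℝ := Real.log (thetaMoment 0 (Real.exp x))

/-- The derivative of `logTheta`. -/
def logThetaDeriv (x : ℝ) : ℝ :=
  -(Real.exp x * thetaMoment 1 (Real.exp x)) / thetaMoment 0 (Real.exp x)

lemma hasDerivAt_thetaMoment_exp (k : ℕ) (x : ℝ) :
    HasDerivAt (fun x => thetaMoment k (Real.exp x))
      (-(thetaMoment (k + 1) (Real.exp x) * Real.exp x)) x := by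
  have := (hasDerivAt_thetaMoment k (Real.exp_pos x)).comp x (Real.hasDerivAt_exp x)
  rwa [neg_mul] at this

lemma hasDerivAt_logTheta (x : ℝ) : HasDerivAt logTheta (logThetaDeriv x) x := by
  have h0 := one_le_thetaMoment_zero (Real.exp_pos x)
  have := (hasDerivAt_thetaMoment_exp 0 x).log (by linarith)
  convert! this using 1
  rw [logThetaDeriv, mul_comm]

lemma logTheta_neg (x : ℝ) : logTheta (-x) = x / 2 + logTheta x := by
  have h0 := one_le_thetaMoment_zero (Real.exp_pos x)
  rw [logTheta, thetaMoment_zero_inv (Real.exp_pos _), Real.exp_neg, inv_inv,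
    Real.log_mul (by positivity) (by linarith), Real.log_rpow (by positivity), Real.log_inv,
    Real.log_exp, logTheta]
  ring

lemma logThetaDeriv_neg (x : ℝ) : logThetaDeriv (-x) = -(1 / 2) - logThetaDeriv x := by
  have h1 := (hasDerivAt_logTheta (-x)).comp x (hasDerivAt_neg x)
  have h2 : HasDerivAt (fun x => x / 2 + logTheta x) (1 / 2 + logThetaDeriv x) x :=
    ((hasDerivAt_id x).div_const 2).add (hasDerivAt_logTheta x)
  have h3 : (logTheta ∘ fun x => -x) = fun x => x / 2 + logTheta x := funext logTheta_neg
  have h4 : HasDerivAt (logTheta ∘ fun x => -x) (logThetaDeriv (-x) * -1) x := h1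
  rw [h3] at h4
  have := h4.unique h2
  linarith

lemma thetaMoment_zero_le_two {s : ℝ} (hs : 1 ≤ s) : thetaMoment 0 s ≤ 2 := by
  refine (thetaMoment_antitone 0 one_pos hs).trans ?_
  have h := logThetaDeriv_neg 0
  have h0 := one_le_thetaMoment_zero one_pos
  have h1 := pi_mul_thetaMoment_zero_sub_one_le one_pos
  have hpi := Real.pi_gt_three
  rw [neg_zero, logThetaDeriv, Real.exp_zero] at h
  have h2 : thetaMoment 1 1 = thetaMoment 0 1 / 4 := by
    have h3 : -(1 * thetaMoment 1 1) / thetaMoment 0 1 = -(1 / 4) := by linarith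
    rw [div_eq_iff (by linarith)] at h3
    linarith
  nlinarith

lemma exists_hasDerivAt_logThetaDeriv {x : ℝ} (hx : 0 ≤ x) :
    ∃ m, HasDerivAt logThetaDeriv m x ∧ thetaMoment 1 (Real.exp x) / 4 ≤ m := by
  have hs : 1 ≤ Real.exp x := Real.one_le_exp hx
  have h0 := one_le_thetaMoment_zero (Real.exp_pos x)
  refine ⟨_, (((Real.hasDerivAt_exp x).mul (hasDerivAt_thetaMoment_exp 1 x)).neg).div
    (hasDerivAt_thetaMoment_exp 0 x) (by linarith), ?_⟩
  have hT := thetaMoment_zero_le_two hs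
  have hpi := Real.pi_gt_three
  have h1 := thetaMoment_one_pos (Real.exp_pos x)
  have h2 := pi_mul_thetaMoment_one_le (Real.exp_pos x)
  have h3 := sq_thetaMoment_one_le (Real.exp_pos x)
  simp only [Pi.neg_apply, Pi.mul_apply]
  norm_num
  generalize thetaMoment 0 (Real.exp x) = A at *
  generalize thetaMoment 1 (Real.exp x) = B at *
  generalize thetaMoment 2 (Real.exp x) = C at *
  generalize Real.exp x = s at *
  have h4 : 3 * B ≤ C := by nlinarith
  have hC : 0 ≤ C := by linarith
  have hsB : 3 * (s * B) ≤ s * C := by nlinarith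
  have key : s * B ≤ (-(s * B) + s * (C * s)) * A - s * B * (B * s) := by
    have e1 : s * s * B ^ 2 ≤ s * s * ((A - 1) * C) := by gcongr
    have e2 : 3 * (s * B) * 1 ≤ s * C * s := by
      gcongr
    have e3 : s * B * A ≤ s * B * 2 := by gcongr
    nlinarith
  rw [div_le_div_iff₀ (by norm_num) (by positivity)]
  have e4 : A ^ 2 ≤ 4 := by nlinarith
  have e5 : B * A ^ 2 ≤ B * 4 := by gcongr
  have e6 : B * 1 ≤ B * s := by gcongr
  nlinarith

lemma monotone_logThetaDeriv : Monotone logThetaDeriv := by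
  have h : MonotoneOn logThetaDeriv (Set.Ici 0) := by
    refine monotoneOn_of_deriv_nonneg (convex_Ici 0) ?_ ?_ ?_
    · intro x hx
      obtain ⟨m, hm, -⟩ := exists_hasDerivAt_logThetaDeriv (Set.mem_Ici.1 hx)
      exact hm.continuousAt.continuousWithinAt
    · intro x hx
      rw [interior_Ici] at hx
      obtain ⟨m, hm, -⟩ := exists_hasDerivAt_logThetaDeriv (Set.mem_Ioi.1 hx).le
      exact hm.differentiableAt.differentiableWithinAt
    · intro x hx
      rw [interior_Ici] at hx
      obtain ⟨m, hm, h⟩ := exists_hasDerivAt_logThetaDeriv (Set.mem_Ioi.1 hx).le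
      rw [hm.deriv]
      have := thetaMoment_nonneg 1 (Real.exp x)
      linarith
  refine MonotoneOn.Iic_union_Ici (a := 0) (fun x hx y hy hxy => ?_) h
  have := h (Set.mem_Ici.2 (neg_nonneg.2 hy)) (Set.mem_Ici.2 (neg_nonneg.2 hx))
    (neg_le_neg hxy)
  rw [logThetaDeriv_neg, logThetaDeriv_neg] at this
  linarith

/-- A lower bound of the second derivative of `logTheta` on `[0, 3]`. -/
lemma logThetaDeriv_sub_ge {x y : ℝ} (hx : 0 ≤ x) (hxy : x ≤ y) (hy : y ≤ 3) :
    thetaMoment 1 (Real.exp 3) / 4 * (y - x) ≤ logThetaDeriv y - logThetaDeriv x := by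
  refine (convex_Icc (0 : ℝ) 3).mul_sub_le_image_sub_of_le_deriv ?_ ?_ ?_ x ⟨hx, hxy.trans hy⟩ y
    ⟨hx.trans hxy, hy⟩ hxy
  · intro z hz
    obtain ⟨m, hm, -⟩ := exists_hasDerivAt_logThetaDeriv hz.1
    exact hm.continuousAt.continuousWithinAt
  · intro z hz
    rw [interior_Icc] at hz
    obtain ⟨m, hm, -⟩ := exists_hasDerivAt_logThetaDeriv hz.1.le
    exact hm.differentiableAt.differentiableWithinAt
  · intro z hz
    rw [interior_Icc] at hz
    obtain ⟨m, hm, h⟩ := exists_hasDerivAt_logThetaDeriv hz.1.le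
    rw [hm.deriv]
    have := thetaMoment_antitone 1 (Real.exp_pos z) (Real.exp_le_exp.2 hz.2.le)
    linarith

lemma monotoneOn_sub_tangent {f f' : ℝ → ℝ} (hf : ∀ x, HasDerivAt f (f' x) x) {x a b c : ℝ}
    (h : ∀ u ∈ Set.Ioo a b, c * u ≤ f' (x + u) - f' x) :
    MonotoneOn (fun u => f (x + u) - f' x * u - c / 2 * u ^ 2) (Set.Icc a b) := by
  have hd (u : ℝ) : HasDerivAt (fun u => f (x + u) - f' x * u - c / 2 * u ^ 2)
      (f' (x + u) - f' x - c * u) u := by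
    have h1 := (hf (x + u)).comp_const_add x u
    have h2 := (hasDerivAt_id u).const_mul (f' x)
    have h3 := ((hasDerivAt_id u).pow 2).const_mul (c / 2)
    convert! (h1.sub h2).sub h3 using 1
    simp
    ring
  refine monotoneOn_of_deriv_nonneg (convex_Icc a b)
    (fun u _ => (hd u).continuousAt.continuousWithinAt)
    (fun u _ => (hd u).differentiableAt.differentiableWithinAt) (fun u hu => ?_)
  rw [interior_Icc] at hu
  rw [(hd u).deriv]
  linarith [h u hu]

lemma antitoneOn_sub_tangent {f f' : ℝ → ℝ} (hf : ∀ x, HasDerivAt f (f' x) x) {x a b c : ℝ}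
    (h : ∀ u ∈ Set.Ioo a b, f' (x + u) - f' x ≤ c * u) :
    AntitoneOn (fun u => f (x + u) - f' x * u - c / 2 * u ^ 2) (Set.Icc a b) := by
  have := monotoneOn_sub_tangent (f := fun x => -f x) (f' := fun x => -f' x)
    (fun x => (hf x).neg) (x := x) (a := a) (b := b) (c := -c) (fun u hu => by linarith [h u hu])
  intro u hu v hv huv
  have := this hu hv huv
  simp only at this ⊢
  linarith

lemma logTheta_tangent_far (x : ℝ) {u v : ℝ} (h : 0 ≤ u ∧ u ≤ v ∨ v ≤ u ∧ u ≤ 0) :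
    logTheta (x + u) - logThetaDeriv x * u ≤ logTheta (x + v) - logThetaDeriv x * v := by
  rcases h with ⟨h0, h1⟩ | ⟨h1, h0⟩
  · have := monotoneOn_sub_tangent hasDerivAt_logTheta (x := x) (a := 0) (b := v) (c := 0)
      (fun w hw => by
        have := monotone_logThetaDeriv (show x ≤ x + w by linarith [hw.1])
        linarith) ⟨h0, h1⟩ ⟨h0.trans h1, le_rfl⟩ h1
    simp only at this
    linarith
  · have := antitoneOn_sub_tangent hasDerivAt_logTheta (x := x) (a := v) (b := 0) (c := 0)
      (fun w hw => by
        have := monotone_logThetaDeriv (show x + w ≤ x by linarith [hw.2])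
        linarith) ⟨le_rfl, h1.trans h0⟩ ⟨h1, h0⟩ h1
    simp only at this
    linarith

lemma logTheta_tangent (x u : ℝ) : logTheta x + logThetaDeriv x * u ≤ logTheta (x + u) := by
  have := logTheta_tangent_far x (u := 0) (v := u)
    ((le_total 0 u).imp (fun h => ⟨le_rfl, h⟩) (fun h => ⟨h, le_rfl⟩))
  rw [add_zero] at this
  linarith

lemma logTheta_tangent_near {x : ℝ} (hx : x ∈ Set.Icc (1 : ℝ) 2) {u : ℝ} (hu : |u| ≤ 1) :
    logTheta x + logThetaDeriv x * u + thetaMoment 1 (Real.exp 3) / 8 * u ^ 2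
      ≤ logTheta (x + u) := by
  obtain ⟨hx1, hx2⟩ := hx
  obtain ⟨hu1, hu2⟩ := abs_le.1 hu
  rcases le_total 0 u with h0 | h0
  · have := monotoneOn_sub_tangent hasDerivAt_logTheta (x := x) (a := 0) (b := u)
      (c := thetaMoment 1 (Real.exp 3) / 4)
      (fun w hw => by
        have := logThetaDeriv_sub_ge (x := x) (y := x + w) (by linarith) (by linarith [hw.1])
          (by linarith [hw.2])
        linarith) ⟨le_rfl, h0⟩ ⟨h0, le_rfl⟩ h0
    simp only [add_zero] at this
    linarith
  · have := antitoneOn_sub_tangent hasDerivAt_logTheta (x := x) (a := u) (b := 0)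
      (c := thetaMoment 1 (Real.exp 3) / 4)
      (fun w hw => by
        have := logThetaDeriv_sub_ge (x := x + w) (y := x) (by linarith [hw.1])
          (by linarith [hw.2]) (by linarith)
        linarith) ⟨le_rfl, h0⟩ ⟨h0, le_rfl⟩ h0
    simp only [add_zero] at this
    linarith

lemma logTheta_tangent_strong {x : ℝ} (hx : x ∈ Set.Icc (1 : ℝ) 2) (u : ℝ) :
    logTheta x + logThetaDeriv x * u + thetaMoment 1 (Real.exp 3) / 8 * min 1 (u ^ 2)
      ≤ logTheta (x + u) := by
  have hT := thetaMoment_nonneg 1 (Real.exp 3)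
  rcases le_total |u| 1 with hu | hu
  · refine le_trans ?_ (logTheta_tangent_near hx hu)
    gcongr
    exact min_le_right _ _
  · have hm := mul_le_mul_of_nonneg_left (min_le_left 1 (u ^ 2)) (div_nonneg hT (by norm_num :
      (0 : ℝ) ≤ 8))
    rcases le_abs'.1 hu with h | h
    · have h1 := logTheta_tangent_near hx (u := -1) (by simp)
      have h2 := logTheta_tangent_far x (u := -1) (v := u) (.inr ⟨h, by norm_num⟩)
      linarith
    · have h1 := logTheta_tangent_near hx (u := 1) (by simp)
      have h2 := logTheta_tangent_far x (u := 1) (v := u) (.inl ⟨by norm_num, h⟩)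
      linarith

lemma hasSum_pi_prod {ι : Type*} {d : ℕ} (f : Fin d → ι → ℝ) (hf : ∀ i m, 0 ≤ f i m)
    (hs : ∀ i, Summable (f i)) :
    HasSum (fun n : Fin d → ι => ∏ i, f i (n i)) (∏ i, ∑' m, f i m) := by
  induction d with
  | zero => simp
  | succ d ih =>
    have h := ih (fun i => f i.succ) (fun i m => hf i.succ m) (fun i => hs i.succ)
    set g : (Fin d → ι) → ℝ := fun n => ∏ i, f i.succ (n i) with hg
    have hg0 : 0 ≤ g := fun n => Finset.prod_nonneg fun i _ => hf _ _
    have hf0 : 0 ≤ f 0 := fun m => hf 0 m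
    have h2 := (hs 0).hasSum.mul h ((hs 0).mul_of_nonneg h.summable hf0 hg0)
    rw [Fin.prod_univ_succ, ← (Fin.consEquiv fun _ : Fin (d + 1) => ι).hasSum_iff]
    refine h2.congr_fun fun x => ?_
    simp [hg, Fin.consEquiv, Fin.prod_univ_succ]

lemma Qf_pos {d : ℕ} {a : Fin d → ℝ} (ha : ∀ i, 0 < a i) {n : Fin d → ℤ} (hn : n ≠ 0) :
    0 < Qf d a n := by
  obtain ⟨i, hi⟩ := Function.ne_iff.1 hn
  have h1 := one_le_sq_cast hi
  have := ha i
  exact Finset.sum_pos' (fun j _ => by positivity) ⟨i, Finset.mem_univ i, by positivity⟩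

lemma one_le_Qf_one {d : ℕ} {n : Fin d → ℤ} (hn : n ≠ 0) : 1 ≤ Qf d (fun _ => 1) n := by
  obtain ⟨i, hi⟩ := Function.ne_iff.1 hn
  refine (one_le_sq_cast hi).trans ?_
  have := Finset.single_le_sum (f := fun j => ((1 : ℝ) ^ 2 * (n j : ℝ) ^ 2))
    (fun j _ => by positivity) (Finset.mem_univ i)
  simpa [Qf] using this

lemma sq_le_Qf_one {d : ℕ} (n : Fin d → ℤ) (i : Fin d) :
    (n i : ℝ) ^ 2 ≤ Qf d (fun _ => 1) n := by
  have := Finset.single_le_sum (f := fun j => ((1 : ℝ) ^ 2 * (n j : ℝ) ^ 2))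
    (fun j _ => by positivity) (Finset.mem_univ i)
  simpa [Qf] using this

lemma Qf_one_le {d : ℕ} {a : Fin d → ℝ} (ha : ∀ i, 0 < a i) (n : Fin d → ℤ) :
    Qf d (fun _ => 1) n ≤ (∑ i, (a i ^ 2)⁻¹) * Qf d a n := by
  simp only [Qf, Finset.mul_sum]
  refine Finset.sum_le_sum fun i _ => ?_
  have hi := ha i
  have := Finset.single_le_sum (f := fun j => (a j ^ 2)⁻¹)
    (fun j _ => by positivity) (Finset.mem_univ i)
  calc (1 : ℝ) ^ 2 * (n i : ℝ) ^ 2 = (a i ^ 2)⁻¹ * (a i ^ 2 * (n i : ℝ) ^ 2) := by field_simp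
    _ ≤ _ := by gcongr

lemma summable_one_add_sq_rpow {r : ℝ} (hr : 1 / 2 < r) :
    Summable fun n : ℤ => (1 + (n : ℝ) ^ 2) ^ (-r) := by
  refine (Real.summable_abs_int_rpow (b := 2 * r) (by linarith)).of_norm_bounded_eventually ?_
  rw [Filter.eventually_cofinite]
  refine (Set.finite_singleton (0 : ℤ)).subset fun n hn => ?_
  by_contra h0
  refine hn ?_
  have hn : n ≠ 0 := h0
  have h2 : (0 : ℝ) < |(n : ℝ)| := by positivity
  rw [Real.norm_of_nonneg (by positivity), ← mul_neg, Real.rpow_mul h2.le]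
  refine Real.rpow_le_rpow_of_nonpos (by positivity) ?_ (by linarith)
  norm_num

lemma prod_one_add_sq_le {d : ℕ} (hd : 1 ≤ d) (n : Fin d → ℤ) :
    ∏ i, (1 + (n i : ℝ) ^ 2) ^ (1 / d : ℝ) ≤ 1 + Qf d (fun _ => 1) n := by
  have hd' : (1 : ℝ) ≤ d := by exact_mod_cast hd
  refine (Real.geom_mean_le_arith_mean_weighted Finset.univ (fun _ => (1 / d : ℝ))
    (fun i => 1 + (n i : ℝ) ^ 2) (fun _ _ => by positivity) (by simp; field_simp)
    (fun _ _ => by positivity)).trans ?_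
  rw [← Finset.mul_sum, Finset.sum_add_distrib]
  have : 0 ≤ ∑ i, (n i : ℝ) ^ 2 := by positivity
  simp only [Qf, Finset.sum_const, Finset.card_univ, Fintype.card_fin, nsmul_eq_mul, mul_one,
    one_pow, one_mul]
  rw [mul_add, one_div, inv_mul_cancel₀ (by positivity)]
  gcongr
  exact mul_le_of_le_one_left this (inv_le_one_of_one_le₀ hd')

lemma summable_Qf_rpow {d : ℕ} (hd : 1 ≤ d) {s : ℝ} (hs : d / 2 < s) {a : Fin d → ℝ}
    (ha : ∀ i, 0 < a i) : Summable fun n : {n : Fin d → ℤ // n ≠ 0} => Qf d a n.1 ^ (-s) := by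
  have hd' : (1 : ℝ) ≤ d := by exact_mod_cast hd
  have hs0 : 0 < s := by linarith
  have hr : 1 / 2 < s / d := by rw [div_lt_div_iff₀ (by norm_num) (by linarith)]; linarith
  have h := (hasSum_pi_prod (fun (_ : Fin d) (n : ℤ) => (1 + (n : ℝ) ^ 2) ^ (-(s / d)))
    (fun _ _ => by positivity) (fun _ => summable_one_add_sq_rpow hr)).summable
  set K := ∑ i, (a i ^ 2)⁻¹ with hK
  have hK0 : 0 < K := Finset.sum_pos (fun i _ => by have := ha i; positivity)
    ⟨⟨0, hd⟩, Finset.mem_univ _⟩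
  refine (((h.subtype {n | n ≠ 0})).mul_left ((2 * K) ^ s)).of_nonneg_of_le
    (fun n => Real.rpow_nonneg (Qf_pos ha n.2).le _) (fun ⟨n, hn⟩ => ?_)
  have hQ := Qf_pos ha hn
  have h1 := one_le_Qf_one hn
  have h2 := Qf_one_le ha n
  have h3 := prod_one_add_sq_le hd n
  have hP : 0 < ∏ i, (1 + (n i : ℝ) ^ 2) ^ (1 / d : ℝ) :=
    Finset.prod_pos fun i _ => by positivity
  have h4 : ∏ i, (1 + (n i : ℝ) ^ 2) ^ (-(s / d)) =
      (∏ i, (1 + (n i : ℝ) ^ 2) ^ (1 / d : ℝ)) ^ (-s) := by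
    rw [← Real.finsetProd_rpow _ _ (fun i _ => by positivity)]
    refine Finset.prod_congr rfl fun i _ => ?_
    rw [← Real.rpow_mul (by positivity)]
    congr 1
    ring
  simp only [Function.comp]
  rw [h4]
  generalize ∏ i, (1 + (n i : ℝ) ^ 2) ^ (1 / d : ℝ) = P at *
  have h5 : P / (2 * K) ≤ Qf d a n := by
    rw [div_le_iff₀ (by positivity)]
    linarith
  calc Qf d a n ^ (-s) ≤ (P / (2 * K)) ^ (-s) :=
        Real.rpow_le_rpow_of_nonpos (by positivity) h5 (by linarith)
    _ = _ := by
        rw [Real.div_rpow hP.le (by positivity), Real.rpow_neg (x := 2 * K) (by positivity)]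
        field_simp

/-- The theta function of the orthorhombic lattice with side lengths `a`. -/
def latticeTheta {d : ℕ} (a : Fin d → ℝ) (t : ℝ) : ℝ := ∏ i, thetaMoment 0 (a i ^ 2 * t)

lemma hasSum_latticeTheta {d : ℕ} {a : Fin d → ℝ} (ha : ∀ i, 0 < a i) {t : ℝ} (ht : 0 < t) :
    HasSum (fun n : {n : Fin d → ℤ // n ≠ 0} => Real.exp (-(Real.pi * Qf d a n.1 * t)))
      (latticeTheta a t - 1) := by
  have h := hasSum_pi_prod (fun (i : Fin d) (n : ℤ) => (Real.pi * (n : ℝ) ^ 2) ^ 0 *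
    Real.exp (-(Real.pi * (n : ℝ) ^ 2 * (a i ^ 2 * t)))) (fun _ _ => by positivity)
    (fun i => summable_thetaMoment 0 (by have := ha i; positivity))
  have h2 := h.sub (hasSum_ite_eq (0 : Fin d → ℤ) (1 : ℝ))
  rw [← hasSum_subtype_iff_of_support_subset (s := {n | n ≠ 0})] at h2
  · refine h2.congr_fun ?_
    rintro ⟨n, hn⟩
    have hn' : n ≠ 0 := hn
    simp only [Function.comp, hn', if_false, sub_zero, pow_zero, one_mul]
    rw [← Real.exp_sum, Qf, Finset.mul_sum, Finset.sum_mul, ← Finset.sum_neg_distrib]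
    congr 1
    exact Finset.sum_congr rfl fun i _ => by ring
  · intro n hn h0
    refine hn ?_
    simp [h0]

lemma one_le_latticeTheta {d : ℕ} {a : Fin d → ℝ} (ha : ∀ i, 0 < a i) {t : ℝ} (ht : 0 < t) :
    1 ≤ latticeTheta a t := by
  have := (hasSum_latticeTheta ha ht).nonneg (fun n => by positivity)
  linarith

/-- The Epstein zeta function as a Mellin transform of the theta function. -/
lemma integral_latticeTheta {d : ℕ} (hd : 1 ≤ d) {s : ℝ} (hs : d / 2 < s) {a : Fin d → ℝ}
    (ha : ∀ i, 0 < a i) :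
    ∫ t in Set.Ioi (0 : ℝ), t ^ (s - 1) * (latticeTheta a t - 1) =
      Real.pi ^ (-s) * Real.Gamma s * ∑' n : {n : Fin d → ℤ // n ≠ 0}, Qf d a n.1 ^ (-s) := by
  have hd' : (1 : ℝ) ≤ d := by exact_mod_cast hd
  have hs0 : 0 < s := by linarith
  have hpos (n : {n : Fin d → ℤ // n ≠ 0}) : 0 < Real.pi * Qf d a n.1 :=
    mul_pos Real.pi_pos (Qf_pos ha n.2)
  have hval (n : {n : Fin d → ℤ // n ≠ 0}) :
      ∫ t in Set.Ioi (0 : ℝ), t ^ (s - 1) * Real.exp (-(Real.pi * Qf d a n.1 * t)) =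
        Real.pi ^ (-s) * Real.Gamma s * Qf d a n.1 ^ (-s) := by
    rw [Real.integral_rpow_mul_exp_neg_mul_Ioi hs0 (hpos n), one_div, ← Real.rpow_neg_one,
      ← Real.rpow_mul (hpos n).le, Real.mul_rpow Real.pi_pos.le (Qf_pos ha n.2).le]
    ring_nf
  have hint (n : {n : Fin d → ℤ // n ≠ 0}) : MeasureTheory.IntegrableOn
      (fun t => t ^ (s - 1) * Real.exp (-(Real.pi * Qf d a n.1 * t))) (Set.Ioi (0 : ℝ)) := by
    refine MeasureTheory.Integrable.of_integral_ne_zero ?_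
    rw [hval]
    have := Real.Gamma_pos_of_pos hs0
    have := Real.rpow_pos_of_pos (Qf_pos ha n.2) (-s)
    positivity
  have h := MeasureTheory.hasSum_integral_of_summable_integral_norm hint ?_
  · rw [← tsum_mul_left, ← tsum_congr hval, h.tsum_eq]
    refine MeasureTheory.setIntegral_congr_fun measurableSet_Ioi fun t ht => ?_
    rw [tsum_mul_left, (hasSum_latticeTheta ha ht).tsum_eq]
  · refine ((summable_Qf_rpow hd hs ha).mul_left (Real.pi ^ (-s) * Real.Gamma s)).congr
      fun n => ?_
    rw [← hval]
    refine MeasureTheory.setIntegral_congr_fun measurableSet_Ioi fun t ht => ?_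
    have : (0 : ℝ) < t := ht
    exact (Real.norm_of_nonneg (by positivity)).symm

lemma tsum_Qf_rpow_pos {d : ℕ} (hd : 1 ≤ d) {s : ℝ} (hs : d / 2 < s) {a : Fin d → ℝ}
    (ha : ∀ i, 0 < a i) : 0 < ∑' n : {n : Fin d → ℤ // n ≠ 0}, Qf d a n.1 ^ (-s) := by
  have h0 : (fun _ => 1 : Fin d → ℤ) ≠ 0 := fun h => by simpa using congrFun h ⟨0, hd⟩
  exact (summable_Qf_rpow hd hs ha).tsum_pos
    (fun n => (Real.rpow_pos_of_pos (Qf_pos ha n.2) _).le) ⟨_, h0⟩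
    (Real.rpow_pos_of_pos (Qf_pos ha h0) _)

lemma integrableOn_latticeTheta {d : ℕ} (hd : 1 ≤ d) {s : ℝ} (hs : d / 2 < s) {a : Fin d → ℝ}
    (ha : ∀ i, 0 < a i) : MeasureTheory.IntegrableOn
      (fun t => t ^ (s - 1) * (latticeTheta a t - 1)) (Set.Ioi (0 : ℝ)) := by
  refine MeasureTheory.Integrable.of_integral_ne_zero ?_
  rw [integral_latticeTheta hd hs ha]
  have hd' : (1 : ℝ) ≤ d := by exact_mod_cast hd
  have := Real.Gamma_pos_of_pos (show 0 < s by linarith)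
  have := tsum_Qf_rpow_pos hd hs ha
  positivity

lemma sum_log_sq_eq_zero {d : ℕ} {a : Fin d → ℝ} (ha : ∀ i, 0 < a i) (hprod : ∏ i, a i = 1) :
    ∑ i, Real.log (a i ^ 2) = 0 := by
  rw [← Real.log_prod (fun i _ => (pow_pos (ha i) 2).ne'), Finset.prod_pow, hprod]
  simp

lemma latticeTheta_one_add_le {d : ℕ} {a : Fin d → ℝ} (ha : ∀ i, 0 < a i)
    (hprod : ∏ i, a i = 1) {t : ℝ} (ht : 0 < t) {e : Fin d → ℝ} (he : ∀ i, 0 ≤ e i)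
    (h : ∀ i, logTheta (Real.log t) + logThetaDeriv (Real.log t) * Real.log (a i ^ 2) + e i
      ≤ logTheta (Real.log t + Real.log (a i ^ 2))) :
    latticeTheta (fun _ : Fin d => 1) t + ∑ i, e i ≤ latticeTheta a t := by
  have hexp (b : Fin d → ℝ) (hb : ∀ i, 0 < b i) : latticeTheta b t =
      Real.exp (∑ i, logTheta (Real.log t + Real.log (b i ^ 2))) := by
    rw [Real.exp_sum]
    refine Finset.prod_congr rfl fun i _ => ?_
    have hbi := hb i
    have h1 := one_le_thetaMoment_zero (show 0 < b i ^ 2 * t by positivity)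
    rw [logTheta, Real.exp_add, Real.exp_log ht, Real.exp_log (pow_pos hbi 2), mul_comm t,
      Real.exp_log (by linarith)]
  have h1 := one_le_latticeTheta (a := fun _ : Fin d => 1) (fun _ => one_pos) ht
  have h2 := Finset.sum_le_sum fun i (_ : i ∈ Finset.univ) => h i
  rw [Finset.sum_add_distrib, Finset.sum_add_distrib, ← Finset.mul_sum,
    sum_log_sq_eq_zero ha hprod, mul_zero, add_zero] at h2
  have h3 : latticeTheta (fun _ : Fin d => 1) t =
      Real.exp (∑ _i : Fin d, logTheta (Real.log t)) := by
    rw [hexp _ (fun _ => one_pos)]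
    simp
  have he' : 0 ≤ ∑ i, e i := Finset.sum_nonneg fun i _ => he i
  calc _ ≤ latticeTheta (fun _ : Fin d => 1) t * (∑ i, e i + 1) := by nlinarith
    _ ≤ latticeTheta (fun _ : Fin d => 1) t * Real.exp (∑ i, e i) := by
        gcongr
        exact Real.add_one_le_exp _
    _ = Real.exp (∑ _i : Fin d, logTheta (Real.log t) + ∑ i, e i) := by rw [h3, Real.exp_add]
    _ ≤ _ := by
        rw [hexp a ha]
        exact Real.exp_le_exp.2 h2

lemma latticeTheta_one_le {d : ℕ} {a : Fin d → ℝ} (ha : ∀ i, 0 < a i)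
    (hprod : ∏ i, a i = 1) {t : ℝ} (ht : 0 < t) :
    latticeTheta (fun _ : Fin d => 1) t ≤ latticeTheta a t := by
  simpa using latticeTheta_one_add_le ha hprod ht (e := fun _ => 0) (fun _ => le_rfl)
    (fun i => by simpa using logTheta_tangent _ _)

/-- A truncated squared distance from `a` to the cubic lattice. -/
def cubicDefect {d : ℕ} (a : Fin d → ℝ) : ℝ := ∑ i, min 1 (Real.log (a i ^ 2) ^ 2)

lemma cubicDefect_nonneg {d : ℕ} (a : Fin d → ℝ) : 0 ≤ cubicDefect a :=
  Finset.sum_nonneg fun _ _ => le_min zero_le_one (sq_nonneg _)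

lemma cubicDefect_pos {d : ℕ} {a : Fin d → ℝ} (ha : ∀ i, 0 < a i) (h : a ≠ fun _ => 1) :
    0 < cubicDefect a := by
  obtain ⟨i, hi⟩ := Function.ne_iff.1 h
  refine Finset.sum_pos' (fun _ _ => le_min zero_le_one (sq_nonneg _)) ⟨i, Finset.mem_univ i, ?_⟩
  have : Real.log (a i ^ 2) ≠ 0 := by
    rw [Real.log_pow]
    exact mul_ne_zero (by norm_num) (Real.log_ne_zero_of_pos_of_ne_one (ha i) hi)
  exact lt_min one_pos (by positivity)

lemma exists_cubicDefect_le {d : ℕ} (hd : 1 ≤ d) {p : ℝ} (hp : d / 2 < p) :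
    ∃ c : ℝ, 0 < c ∧ ∀ a : Fin d → ℝ, (∀ i, 0 < a i) → ∏ i, a i = 1 →
      c * cubicDefect a ≤ (∑' n : {n : Fin d → ℤ // n ≠ 0}, Qf d a n.1 ^ (-p))
        - ∑' n : {n : Fin d → ℤ // n ≠ 0}, Qf d (fun _ => 1) n.1 ^ (-p) := by
  have hd' : (1 : ℝ) ≤ d := by exact_mod_cast hd
  have hp0 : 0 < p := by linarith
  have hG : 0 < Real.pi ^ (-p) * Real.Gamma p := by
    have := Real.Gamma_pos_of_pos hp0
    positivity
  set κ := thetaMoment 1 (Real.exp 3) / 8 with hκ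
  have hκ0 : 0 < κ := by
    have := thetaMoment_one_pos (Real.exp_pos 3)
    positivity
  have h12 : Real.exp 1 < Real.exp 2 := Real.exp_lt_exp.2 (by norm_num)
  refine ⟨(Real.exp 2 - Real.exp 1) * (Real.exp (-2) * κ) / (Real.pi ^ (-p) * Real.Gamma p),
    ?_, fun a ha hprod => ?_⟩
  · have := sub_pos.2 h12
    positivity
  have hI := integrableOn_latticeTheta hd hp ha
  have hI1 := integrableOn_latticeTheta hd hp (a := fun _ : Fin d => 1) (fun _ => one_pos)
  have hsub := MeasureTheory.integral_sub hI hI1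
  rw [integral_latticeTheta hd hp ha, integral_latticeTheta hd hp (fun _ => one_pos),
    ← mul_sub] at hsub
  rw [div_mul_eq_mul_div, div_le_iff₀ hG, mul_comm (_ - _) (Real.pi ^ (-p) * _), ← hsub]
  have hle : ∫ t in Set.Ioc (Real.exp 1) (Real.exp 2), (Real.exp (-2) * κ * cubicDefect a) ≤
      ∫ t in Set.Ioc (Real.exp 1) (Real.exp 2), (t ^ (p - 1) * (latticeTheta a t - 1) -
        t ^ (p - 1) * (latticeTheta (fun _ : Fin d => 1) t - 1)) := by
    have hconst : MeasureTheory.IntegrableOn (fun _ : ℝ => Real.exp (-2) * κ * cubicDefect a)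
        (Set.Ioc (Real.exp 1) (Real.exp 2)) :=
      continuousOn_const.integrableOn_Icc.mono_set Set.Ioc_subset_Icc_self
    refine MeasureTheory.setIntegral_mono_on hconst ?_ measurableSet_Ioc fun t ht => ?_
    · exact (hI.sub hI1).mono_set fun t ht => (Real.exp_pos 1).trans ht.1
    · have ht0 : 0 < t := (Real.exp_pos 1).trans ht.1
      have hlog : Real.log t ∈ Set.Icc (1 : ℝ) 2 :=
        ⟨(Real.le_log_iff_exp_le ht0).2 ht.1.le, (Real.log_le_iff_le_exp ht0).2 ht.2⟩
      have h := latticeTheta_one_add_le ha hprod ht0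
        (e := fun i => κ * min 1 (Real.log (a i ^ 2) ^ 2))
        (fun i => mul_nonneg hκ0.le (le_min zero_le_one (sq_nonneg _)))
        (fun i => logTheta_tangent_strong hlog _)
      rw [← Finset.mul_sum] at h
      change _ + κ * cubicDefect a ≤ _ at h
      have hpow : Real.exp (-2) ≤ t ^ (p - 1) := by
        rw [Real.rpow_def_of_pos ht0]
        refine Real.exp_le_exp.2 ?_
        nlinarith [hlog.1, hlog.2]
      have := cubicDefect_nonneg a
      calc Real.exp (-2) * κ * cubicDefect a = Real.exp (-2) * (κ * cubicDefect a) := by ring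
        _ ≤ t ^ (p - 1) * (κ * cubicDefect a) := by gcongr
        _ ≤ t ^ (p - 1) * (latticeTheta a t - latticeTheta (fun _ : Fin d => 1) t) := by
            gcongr
            linarith
        _ = _ := by ring
  rw [MeasureTheory.setIntegral_const, Real.volume_real_Ioc_of_le h12.le, smul_eq_mul] at hle
  refine le_trans (by linarith) (hle.trans ?_)
  refine MeasureTheory.setIntegral_mono_set (hI.sub hI1) ?_ ?_
  · rw [Filter.EventuallyLE, MeasureTheory.ae_restrict_iff' measurableSet_Ioi]
    refine Filter.Eventually.of_forall fun t ht => ?_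
    have ht0 : (0 : ℝ) < t := ht
    have := latticeTheta_one_le ha hprod ht0
    change 0 ≤ _ - _
    rw [← mul_sub]
    exact mul_nonneg (by positivity) (by linarith)
  · exact Filter.Eventually.of_forall fun t ht => (Real.exp_pos 1).trans ht.1

lemma thetaMoment_zero_mul_le {s t : ℝ} (hs : 0 < s) (ht : 0 < t) (ht1 : t ≤ 1) :
    thetaMoment 0 (s * t) ≤ t ^ (-(1 / 2) : ℝ) * thetaMoment 0 s := by
  rw [thetaMoment_zero_inv (mul_pos hs ht), thetaMoment_zero_inv hs,
    Real.mul_rpow hs.le ht.le, mul_comm (s ^ _), mul_assoc]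
  gcongr
  refine thetaMoment_antitone 0 (inv_pos.2 hs) (inv_anti₀ (by positivity) ?_)
  exact mul_le_of_le_one_right hs.le ht1

lemma latticeTheta_le_mul {d : ℕ} {a : Fin d → ℝ} (ha : ∀ i, 0 < a i) {t : ℝ} (ht : 0 < t)
    (ht1 : t ≤ 1) : latticeTheta a t ≤ t ^ (-(d / 2) : ℝ) * latticeTheta a 1 := by
  have h : latticeTheta a t ≤ ∏ i, t ^ (-(1 / 2) : ℝ) * thetaMoment 0 (a i ^ 2) :=
    Finset.prod_le_prod (fun _ _ => thetaMoment_nonneg _ _)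
      (fun i _ => thetaMoment_zero_mul_le (pow_pos (ha i) 2) ht ht1)
  refine h.trans_eq ?_
  rw [Finset.prod_mul_distrib, latticeTheta, Finset.prod_const, Finset.card_univ,
    Fintype.card_fin, ← Real.rpow_natCast, ← Real.rpow_mul ht.le]
  simp only [mul_one]
  congr 2
  ring

lemma latticeTheta_antitone {d : ℕ} {a : Fin d → ℝ} (ha : ∀ i, 0 < a i) {s t : ℝ} (hs : 0 < s)
    (hst : s ≤ t) : latticeTheta a t ≤ latticeTheta a s :=
  Finset.prod_le_prod (fun _ _ => thetaMoment_nonneg _ _) fun i _ =>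
    thetaMoment_antitone 0 (mul_pos (pow_pos (ha i) 2) hs)
      (mul_le_mul_of_nonneg_left hst (sq_nonneg _))

lemma setIntegral_Ioc_rpow {r : ℝ} (hr : 0 < r) (C : ℝ) :
    MeasureTheory.IntegrableOn (fun t : ℝ => t ^ (r - 1) * C) (Set.Ioc 0 1) ∧
      ∫ t in Set.Ioc (0 : ℝ) 1, t ^ (r - 1) * C = C / r := by
  constructor
  · have := intervalIntegral.intervalIntegrable_rpow' (a := 0) (b := 1)
      (show -1 < r - 1 by linarith)
    exact ((intervalIntegrable_iff_integrableOn_Ioc_of_le zero_le_one).1 this).mul_const C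
  · rw [← intervalIntegral.integral_of_le zero_le_one, intervalIntegral.integral_mul_const,
      integral_rpow (.inl (by linarith))]
    have : r ≠ 0 := hr.ne'
    simp [this]
    ring

lemma exists_tsum_Qf_rpow_le {d : ℕ} (hd : 1 ≤ d) {p q : ℝ} (hq : d / 2 < q) (hpq : q < p) :
    ∃ C : ℝ, 0 < C ∧ ∀ a : Fin d → ℝ, (∀ i, 0 < a i) →
      ∑' n : {n : Fin d → ℤ // n ≠ 0}, Qf d a n.1 ^ (-q) ≤
        C * (1 + ∑' n : {n : Fin d → ℤ // n ≠ 0}, Qf d a n.1 ^ (-p)) := by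
  have hd' : (1 : ℝ) ≤ d := by exact_mod_cast hd
  have hq0 : 0 < q := by linarith
  have hp0 : 0 < p := by linarith
  have hp : d / 2 < p := by linarith
  have hGq : 0 < Real.pi ^ (-q) * Real.Gamma q := by
    have := Real.Gamma_pos_of_pos hq0
    positivity
  have hGp : 0 < Real.pi ^ (-p) * Real.Gamma p := by
    have := Real.Gamma_pos_of_pos hp0
    positivity
  set A := Real.pi ^ (-q) * Real.Gamma q
  set B := Real.pi ^ (-p) * Real.Gamma p
  set r := q - d / 2 with hr
  have hr0 : 0 < r := by linarith
  refine ⟨(B + (1 + p * B) / r) / A, by positivity, fun a ha => ?_⟩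
  have hIq := integrableOn_latticeTheta hd hq ha
  have hIp := integrableOn_latticeTheta hd hp ha
  have hVq := integral_latticeTheta hd hq ha
  have hVp := integral_latticeTheta hd hp ha
  have hZp := tsum_Qf_rpow_pos hd hp ha
  set Zq := ∑' n : {n : Fin d → ℤ // n ≠ 0}, Qf d a n.1 ^ (-q)
  set Zp := ∑' n : {n : Fin d → ℤ // n ≠ 0}, Qf d a n.1 ^ (-p)
  change _ = A * Zq at hVq
  change _ = B * Zp at hVp
  have hsub : Set.Ioc (0 : ℝ) 1 ⊆ Set.Ioi 0 := fun t ht => ht.1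
  have hsub' : Set.Ioi (1 : ℝ) ⊆ Set.Ioi 0 := fun t ht => zero_lt_one.trans (Set.mem_Ioi.1 ht)
  have hW1 := one_le_latticeTheta ha one_pos
  have hnn : ∀ s t : ℝ, 0 < t → 0 ≤ t ^ (s - 1) * (latticeTheta a t - 1) := fun s t ht =>
    mul_nonneg (by positivity) (sub_nonneg.2 (one_le_latticeTheta ha ht))
  have hnn_ae : 0 ≤ᵐ[MeasureTheory.volume.restrict (Set.Ioi 0)]
      fun t => t ^ (p - 1) * (latticeTheta a t - 1) := by
    rw [Filter.EventuallyLE, MeasureTheory.ae_restrict_iff' measurableSet_Ioi]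
    exact Filter.Eventually.of_forall fun t ht => hnn p t ht
  have h1 : (latticeTheta a 1 - 1) / p ≤ B * Zp := by
    rw [← (setIntegral_Ioc_rpow hp0 _).2, ← hVp]
    refine (MeasureTheory.setIntegral_mono_on (setIntegral_Ioc_rpow hp0 _).1
      (hIp.mono_set hsub) measurableSet_Ioc fun t ht => ?_).trans
      (MeasureTheory.setIntegral_mono_set hIp hnn_ae (Filter.Eventually.of_forall hsub))
    have := latticeTheta_antitone ha ht.1 ht.2
    have := ht.1
    gcongr
  have h2 : ∫ t in Set.Ioc (0 : ℝ) 1, t ^ (q - 1) * (latticeTheta a t - 1) ≤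
      latticeTheta a 1 / r := by
    rw [← (setIntegral_Ioc_rpow hr0 _).2]
    refine MeasureTheory.setIntegral_mono_on (hIq.mono_set hsub)
      (setIntegral_Ioc_rpow hr0 _).1 measurableSet_Ioc fun t ht => ?_
    have ht0 := ht.1
    have h := latticeTheta_le_mul ha ht.1 ht.2
    calc t ^ (q - 1) * (latticeTheta a t - 1)
        ≤ t ^ (q - 1) * (t ^ (-(d / 2) : ℝ) * latticeTheta a 1) := by
          gcongr
          linarith
      _ = _ := by
          rw [← mul_assoc, ← Real.rpow_add ht0, hr]
          ring_nf
  have h3 : ∫ t in Set.Ioi (1 : ℝ), t ^ (q - 1) * (latticeTheta a t - 1) ≤ B * Zp := by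
    rw [← hVp]
    refine (MeasureTheory.setIntegral_mono_on (hIq.mono_set hsub')
      (hIp.mono_set hsub') measurableSet_Ioi fun t ht => ?_).trans
      (MeasureTheory.setIntegral_mono_set hIp hnn_ae (Filter.Eventually.of_forall hsub'))
    have ht1 : (1 : ℝ) < t := ht
    have := one_le_latticeTheta ha (one_pos.trans ht1)
    refine mul_le_mul_of_nonneg_right ?_ (by linarith)
    exact Real.rpow_le_rpow_of_exponent_le ht1.le (by linarith)
  have h4 : A * Zq ≤ latticeTheta a 1 / r + B * Zp := by
    rw [← hVq, ← Set.Ioc_union_Ioi_eq_Ioi zero_le_one, MeasureTheory.setIntegral_union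
      (Set.Ioc_disjoint_Ioi le_rfl) measurableSet_Ioi (hIq.mono_set hsub) (hIq.mono_set hsub')]
    exact add_le_add h2 h3
  rw [div_mul_eq_mul_div, le_div_iff₀ hGq, mul_comm Zq]
  refine h4.trans ?_
  rw [div_le_iff₀ hp0] at h1
  have h5 : latticeTheta a 1 / r ≤ (1 + p * B) * (1 + Zp) / r := by
    gcongr
    nlinarith [mul_pos hp0 hGp]
  calc _ ≤ (1 + p * B) * (1 + Zp) / r + B * (1 + Zp) := by
        gcongr
        linarith
    _ = _ := by ring

lemma exists_abs_rpow_neg_sub_le {q : ℝ} (hq : 0 < q) :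
    ∃ C : ℝ, 0 < C ∧ ∀ r : ℝ, Real.exp (-1) ≤ r → r ≤ Real.exp 1 →
      |r ^ (-q) - 1 + q * (r - 1)| ≤ C * (r - 1) ^ 2 := by
  refine ⟨(1 + Real.exp q + q) * (9 * q ^ 2) + 3 * q, by positivity, fun r h1 h2 => ?_⟩
  have hr : 0 < r := (Real.exp_pos _).trans_le h1
  have hL1 : -1 ≤ Real.log r := (Real.le_log_iff_exp_le hr).2 h1
  have hL2 : Real.log r ≤ 1 := (Real.log_le_iff_le_exp hr).2 h2
  have hle := Real.log_le_sub_one_of_pos hr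
  have hge := Real.one_sub_inv_le_log_of_pos hr
  have hinv : r⁻¹ ≤ 3 := by
    rw [inv_le_comm₀ hr (by norm_num)]
    refine le_trans ?_ h1
    rw [Real.exp_neg]
    exact inv_anti₀ (Real.exp_pos 1) (by linarith [Real.exp_one_lt_d9])
  have hri : r * r⁻¹ = 1 := mul_inv_cancel₀ hr.ne'
  have hri0 : 0 < r⁻¹ := inv_pos.2 hr
  have hdiff : r - 1 - Real.log r ≤ 3 * (r - 1) ^ 2 := by
    have e : r - 1 - (1 - r⁻¹) = (r - 1) ^ 2 * r⁻¹ := by linear_combination (2 - r) * hri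
    nlinarith [sq_nonneg (r - 1)]
  have hLsq : Real.log r ^ 2 ≤ 9 * (r - 1) ^ 2 := by
    rcases le_total 0 (Real.log r) with h | h
    · nlinarith
    · have e : 1 - r⁻¹ = (r - 1) * r⁻¹ := by linear_combination -hri
      have h4 : r - 1 ≤ 0 ∨ 0 ≤ r - 1 := le_total _ _
      rcases h4 with h4 | h4
      · have : 3 * (r - 1) ≤ Real.log r := by nlinarith
        nlinarith
      · have : Real.log r = 0 := le_antisymm h (by nlinarith [mul_nonneg h4 hri0.le])
        rw [this]
        nlinarith [sq_nonneg (r - 1)]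
  have hexp : |Real.exp (-q * Real.log r) - 1 - (-q * Real.log r)|
      ≤ (1 + Real.exp q + q) * (-q * Real.log r) ^ 2 := by
    have hy : |-q * Real.log r| ≤ q := by
      rw [abs_mul, abs_neg, abs_of_pos hq]
      exact mul_le_of_le_one_right hq.le (abs_le.2 ⟨hL1, hL2⟩)
    generalize -q * Real.log r = y at *
    rcases le_total |y| 1 with h | h
    · refine (Real.abs_exp_sub_one_sub_id_le h).trans ?_
      have := Real.exp_pos q
      nlinarith [sq_nonneg y]
    · have h5 : 1 ≤ y ^ 2 := (one_le_sq_iff_one_le_abs y).2 h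
      have h6 := Real.add_one_le_exp y
      have h7 := Real.exp_le_exp.2 ((le_abs_self y).trans hy)
      have h8 := neg_le_of_abs_le hy
      have h9 := Real.exp_pos q
      rw [abs_of_nonneg (by linarith)]
      nlinarith
  have hrw : r ^ (-q) - 1 + q * (r - 1) =
      (Real.exp (-q * Real.log r) - 1 - (-q * Real.log r)) + q * (r - 1 - Real.log r) := by
    rw [Real.rpow_def_of_pos hr, mul_comm (Real.log r)]
    ring
  rw [hrw]
  refine (abs_add_le _ _).trans ?_
  rw [abs_of_nonneg (show 0 ≤ q * (r - 1 - Real.log r) from mul_nonneg hq.le (by linarith))]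
  have e1 := mul_le_mul_of_nonneg_left hLsq
    (show 0 ≤ (1 + Real.exp q + q) * q ^ 2 by positivity)
  have e2 := mul_le_mul_of_nonneg_left hdiff hq.le
  nlinarith

lemma abs_altSign {d : ℕ} (n : Fin d → ℤ) : |altSign d n| = 1 := by
  simp [altSign, abs_zpow]

lemma altSign_comp_perm {d : ℕ} (n : Fin d → ℤ) (σ : Equiv.Perm (Fin d)) :
    altSign d (n ∘ σ) = altSign d n := by
  simp only [altSign, Function.comp]
  rw [Equiv.sum_comp σ n]

lemma Qf_one_comp_perm {d : ℕ} (n : Fin d → ℤ) (σ : Equiv.Perm (Fin d)) :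
    Qf d (fun _ => 1) (n ∘ σ) = Qf d (fun _ => 1) n := by
  simp only [Qf, Function.comp]
  exact Equiv.sum_comp σ fun i => (1 : ℝ) ^ 2 * (n i : ℝ) ^ 2

/-- Permuting coordinates shows that all diagonal second moments of a symmetric weight agree. -/
lemma tsum_altSign_mul_sq_eq {d : ℕ} (g : ℝ → ℝ) (i j : Fin d) :
    ∑' n : {n : Fin d → ℤ // n ≠ 0},
        altSign d n.1 * g (Qf d (fun _ => 1) n.1) * (n.1 i : ℝ) ^ 2 =
      ∑' n : {n : Fin d → ℤ // n ≠ 0},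
        altSign d n.1 * g (Qf d (fun _ => 1) n.1) * (n.1 j : ℝ) ^ 2 := by
  let e : (Fin d → ℤ) ≃ (Fin d → ℤ) := Equiv.arrowCongr (Equiv.swap i j) (Equiv.refl ℤ)
  have he (n : Fin d → ℤ) : e n = n ∘ (Equiv.swap i j) := by
    ext k
    simp [e, Equiv.arrowCongr]
  let E : {n : Fin d → ℤ // n ≠ 0} ≃ {n : Fin d → ℤ // n ≠ 0} :=
    e.subtypeEquiv fun n => by
      have : e 0 = 0 := by
        rw [he]
        rfl
      rw [not_iff_not, ← this, e.apply_eq_iff_eq]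
      rw [this]
  rw [← E.tsum_eq]
  refine tsum_congr fun n => ?_
  have hE : (E n).1 = n.1 ∘ (Equiv.swap i j) := he n.1
  rw [hE, altSign_comp_perm, Qf_one_comp_perm]
  simp

lemma summable_altSign_mul {d : ℕ} {f : {n : Fin d → ℤ // n ≠ 0} → ℝ} (hf : Summable f) :
    Summable fun n => altSign d n.1 * f n :=
  hf.abs.of_norm_bounded fun n => by rw [norm_mul, Real.norm_eq_abs, abs_altSign, one_mul]; rfl

lemma abs_tsum_altSign_mul_le {d : ℕ} {f : {n : Fin d → ℤ // n ≠ 0} → ℝ} (hf : Summable f)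
    (hf0 : ∀ n, 0 ≤ f n) : |∑' n, altSign d n.1 * f n| ≤ ∑' n, f n :=
  tsum_of_norm_bounded (f := fun n => altSign d n.1 * f n) hf.hasSum fun n => by
    rw [norm_mul, Real.norm_eq_abs, abs_altSign, one_mul, Real.norm_of_nonneg (hf0 n)]

/-- The alternating Epstein zeta function has a critical point at the cubic lattice, with a
quadratic error bound. -/
lemma exists_alternating_sub_le {d : ℕ} (hd : 1 ≤ d) {q : ℝ} (hq : d / 2 < q) :
    ∃ C : ℝ, 0 < C ∧ ∀ a : Fin d → ℝ, (∀ i, 0 < a i) → ∏ i, a i = 1 →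
      (∀ i, |Real.log (a i ^ 2)| ≤ 1) →
      (∑' n : {n : Fin d → ℤ // n ≠ 0}, altSign d n.1 * Qf d (fun _ => 1) n.1 ^ (-q))
        - ∑' n : {n : Fin d → ℤ // n ≠ 0}, altSign d n.1 * Qf d a n.1 ^ (-q)
        ≤ C * ∑ i, Real.log (a i ^ 2) ^ 2 := by
  have hd' : (1 : ℝ) ≤ d := by exact_mod_cast hd
  have hq0 : 0 < q := by linarith
  obtain ⟨C, hC, hCr⟩ := exists_abs_rpow_neg_sub_le hq0
  have hone : ∀ _ : Fin d, (0 : ℝ) < 1 := fun _ => one_pos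
  have hZ := summable_Qf_rpow hd hq hone
  have hQ1 (n : {n : Fin d → ℤ // n ≠ 0}) : 0 < Qf d (fun _ => 1) n.1 := Qf_pos hone n.2
  set Z := ∑' n : {n : Fin d → ℤ // n ≠ 0}, Qf d (fun _ => 1) n.1 ^ (-q) with hZdef
  have hZ0 : 0 < Z := tsum_Qf_rpow_pos hd hq hone
  let τ (i : Fin d) (n : {n : Fin d → ℤ // n ≠ 0}) : ℝ :=
    altSign d n.1 * (Qf d (fun _ => 1) n.1 ^ (-q) / Qf d (fun _ => 1) n.1) * (n.1 i : ℝ) ^ 2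
  have hτ (i : Fin d) : Summable (τ i) := by
    refine hZ.of_norm_bounded fun n => ?_
    have h0 := hQ1 n
    have h1 := sq_le_Qf_one n.1 i
    rw [norm_mul, norm_mul, Real.norm_eq_abs, abs_altSign, one_mul,
      Real.norm_of_nonneg (by positivity), Real.norm_of_nonneg (by positivity),
      div_mul_eq_mul_div, div_le_iff₀ h0]
    gcongr
  set σ := ∑' n, τ ⟨0, hd⟩ n with hσ
  have hτσ (i : Fin d) : HasSum (τ i) σ := by
    rw [hσ, tsum_altSign_mul_sq_eq (fun x => x ^ (-q) / x) ⟨0, hd⟩ i]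
    exact (hτ i).hasSum
  refine ⟨q * |σ| + C * (4 * d) * Z, by positivity, fun a ha hprod hu => ?_⟩
  set S := ∑ i, Real.log (a i ^ 2) ^ 2 with hS
  have hexp (i : Fin d) : a i ^ 2 = Real.exp (Real.log (a i ^ 2)) :=
    (Real.exp_log (pow_pos (ha i) 2)).symm
  have hv (i : Fin d) : |a i ^ 2 - 1| ≤ 2 * |Real.log (a i ^ 2)| := by
    conv_lhs => rw [hexp i]
    exact Real.abs_exp_sub_one_le (hu i)
  have hsumv : |∑ i, (a i ^ 2 - 1)| ≤ S := by
    have e : ∑ i, (a i ^ 2 - 1) = ∑ i, (a i ^ 2 - 1 - Real.log (a i ^ 2)) := by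
      rw [Finset.sum_sub_distrib (fun i => a i ^ 2 - 1), sum_log_sq_eq_zero ha hprod, sub_zero]
    rw [e]
    refine (Finset.abs_sum_le_sum_abs _ _).trans (Finset.sum_le_sum fun i _ => ?_)
    conv_lhs => rw [hexp i, Real.log_exp]
    exact Real.abs_exp_sub_one_sub_id_le (hu i)
  have hsqv : (∑ i, |a i ^ 2 - 1|) ^ 2 ≤ 4 * d * S := by
    have := sq_sum_le_card_mul_sum_sq (s := Finset.univ) (f := fun i : Fin d => |a i ^ 2 - 1|)
    rw [Finset.card_univ, Fintype.card_fin] at this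
    refine this.trans ?_
    rw [mul_assoc, mul_left_comm, hS, Finset.mul_sum (a := (4 : ℝ))]
    gcongr with i
    calc |a i ^ 2 - 1| ^ 2 ≤ (2 * |Real.log (a i ^ 2)|) ^ 2 := by
          gcongr
          exact hv i
      _ = _ := by rw [mul_pow, sq_abs]; norm_num
  have hterm (n : {n : Fin d → ℤ // n ≠ 0}) :
      altSign d n.1 * Qf d (fun _ => 1) n.1 ^ (-q) - altSign d n.1 * Qf d a n.1 ^ (-q) ≤
        q * ∑ i, (a i ^ 2 - 1) * τ i n + C * (4 * d * S) * Qf d (fun _ => 1) n.1 ^ (-q) := by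
    have h0 := hQ1 n
    set Q := Qf d (fun _ => 1) n.1 with hQdef
    set D := ∑ i, (a i ^ 2 - 1) * (n.1 i : ℝ) ^ 2 with hD
    have hQa : Qf d a n.1 = Q * (1 + D / Q) := by
      rw [mul_add, mul_div_cancel₀ _ h0.ne', mul_one, hQdef, hD]
      simp only [Qf]
      rw [← Finset.sum_add_distrib]
      exact Finset.sum_congr rfl fun i _ => by ring
    have hr1 : Real.exp (-1) ≤ 1 + D / Q := by
      refine le_of_mul_le_mul_left ?_ h0
      rw [← hQa, mul_comm, hQdef]
      simp only [Qf, Finset.mul_sum]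
      refine Finset.sum_le_sum fun i _ => ?_
      rw [one_pow, one_mul, hexp i]
      gcongr
      exact neg_le_of_abs_le (hu i)
    have hr2 : 1 + D / Q ≤ Real.exp 1 := by
      refine le_of_mul_le_mul_left ?_ h0
      rw [← hQa, mul_comm, hQdef]
      simp only [Qf, Finset.mul_sum]
      refine Finset.sum_le_sum fun i _ => ?_
      rw [one_pow, one_mul, hexp i]
      gcongr
      exact le_of_abs_le (hu i)
    have hDQ : (D / Q) ^ 2 ≤ 4 * d * S := by
      refine le_trans ?_ hsqv
      rw [← sq_abs]
      gcongr
      rw [abs_div, abs_of_pos h0, div_le_iff₀ h0, Finset.sum_mul]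
      refine (Finset.abs_sum_le_sum_abs _ _).trans (Finset.sum_le_sum fun i _ => ?_)
      rw [abs_mul, abs_of_nonneg (sq_nonneg (n.1 i : ℝ))]
      gcongr
      exact sq_le_Qf_one n.1 i
    have hlin : ∑ i, (a i ^ 2 - 1) * τ i n = altSign d n.1 * Q ^ (-q) * (D / Q) := by
      rw [hD, Finset.sum_div, Finset.mul_sum]
      exact Finset.sum_congr rfl fun i _ => by simp only [τ]; ring
    have hTay := hCr _ hr1 hr2
    rw [add_sub_cancel_left] at hTay
    rw [hlin, hQa, Real.mul_rpow h0.le ((Real.exp_pos _).le.trans hr1)]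
    set R := (1 + D / Q) ^ (-q)
    have hQq : 0 < Q ^ (-q) := by positivity
    have habs : -(altSign d n.1 * (R - 1 + q * (D / Q))) ≤ C * (4 * d * S) := by
      refine (neg_le_abs _).trans ?_
      rw [abs_mul, abs_altSign, one_mul]
      exact hTay.trans (by gcongr)
    nlinarith [mul_le_mul_of_nonneg_left habs hQq.le]
  have hA1 := (summable_altSign_mul hZ).hasSum
  have hAa := (summable_altSign_mul (summable_Qf_rpow hd hq ha)).hasSum
  have hlhs := hA1.sub hAa
  have hrhs := ((hasSum_sum fun i (_ : i ∈ Finset.univ) =>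
    (hτσ i).mul_left (a i ^ 2 - 1)).mul_left q).add (hZ.hasSum.mul_left (C * (4 * d * S)))
  refine (hasSum_le hterm hlhs hrhs).trans ?_
  rw [← Finset.sum_mul, ← hZdef]
  have hσle : (∑ i, (a i ^ 2 - 1)) * σ ≤ S * |σ| := by
    refine (le_abs_self _).trans ?_
    rw [abs_mul]
    gcongr
  nlinarith [mul_le_mul_of_nonneg_left hσle hq0.le]

/-- The variation of the alternating energy is controlled by that of the Epstein energy. -/
lemma exists_alternating_sub_le_mul {d : ℕ} (hd : 1 ≤ d) {p q : ℝ} (hq : d / 2 < q)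
    (hpq : q < p) : ∃ K : ℝ, 0 < K ∧ ∀ a : Fin d → ℝ, (∀ i, 0 < a i) → ∏ i, a i = 1 →
      (∑' n : {n : Fin d → ℤ // n ≠ 0}, altSign d n.1 * Qf d (fun _ => 1) n.1 ^ (-q))
        - ∑' n : {n : Fin d → ℤ // n ≠ 0}, altSign d n.1 * Qf d a n.1 ^ (-q)
        ≤ K * ((∑' n : {n : Fin d → ℤ // n ≠ 0}, Qf d a n.1 ^ (-p))
          - ∑' n : {n : Fin d → ℤ // n ≠ 0}, Qf d (fun _ => 1) n.1 ^ (-p)) := by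
  have hp : d / 2 < p := hq.trans hpq
  have hone : ∀ _ : Fin d, (0 : ℝ) < 1 := fun _ => one_pos
  obtain ⟨c, hc, hlow⟩ := exists_cubicDefect_le hd hp
  obtain ⟨C₁, hC₁, hfar⟩ := exists_tsum_Qf_rpow_le hd hq hpq
  obtain ⟨C₂, hC₂, hnear⟩ := exists_alternating_sub_le hd hq
  have hZp := tsum_Qf_rpow_pos hd hp hone
  have hZq := tsum_Qf_rpow_pos hd hq hone
  have hA1 := abs_tsum_altSign_mul_le (summable_Qf_rpow hd hq hone)
    (fun n => (Real.rpow_pos_of_pos (Qf_pos hone n.2) _).le)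
  set P := ∑' n : {n : Fin d → ℤ // n ≠ 0}, Qf d (fun _ => 1) n.1 ^ (-p)
  set Z := ∑' n : {n : Fin d → ℤ // n ≠ 0}, Qf d (fun _ => 1) n.1 ^ (-q)
  set M := Z + C₁ * (1 + P) with hM
  have hM0 : 0 < M := by positivity
  refine ⟨C₂ / c + (M / c + C₁), by positivity, fun a ha hprod => ?_⟩
  have hl := hlow a ha hprod
  have hdef := cubicDefect_nonneg a
  have hAa := abs_tsum_altSign_mul_le (summable_Qf_rpow hd hq ha)
    (fun n => (Real.rpow_pos_of_pos (Qf_pos ha n.2) _).le)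
  have hf := hfar a ha
  have hn := hnear a ha hprod
  set Δ := (∑' n : {n : Fin d → ℤ // n ≠ 0}, Qf d a n.1 ^ (-p)) - P with hΔ
  have hdefΔ : cubicDefect a ≤ Δ / c := by
    rw [le_div_iff₀ hc]
    linarith
  have hΔ0 : 0 ≤ Δ := le_trans (by positivity) hl
  have e1 : 0 ≤ C₂ / c * Δ := by positivity
  have e2 : 0 ≤ (M / c + C₁) * Δ := by positivity
  by_cases hu : ∀ i, |Real.log (a i ^ 2)| ≤ 1
  · have h1 : ∑ i, Real.log (a i ^ 2) ^ 2 = cubicDefect a :=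
      Finset.sum_congr rfl fun i _ => (min_eq_right ((sq_le_one_iff_abs_le_one _).2 (hu i))).symm
    have h2 := hn hu
    rw [h1] at h2
    have h3 := mul_le_mul_of_nonneg_left hdefΔ hC₂.le
    have h4 : C₂ * (Δ / c) = C₂ / c * Δ := by ring
    linarith
  · push Not at hu
    obtain ⟨i, hi⟩ := hu
    have h1 : 1 ≤ cubicDefect a := by
      have := Finset.single_le_sum (f := fun j => min 1 (Real.log (a j ^ 2) ^ 2))
        (fun j _ => le_min zero_le_one (sq_nonneg _)) (Finset.mem_univ i)
      refine le_trans ?_ this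
      exact le_min le_rfl ((one_le_sq_iff_one_le_abs _).2 hi.le)
    have h2 : M ≤ M * (Δ / c) := le_mul_of_one_le_right hM0.le (h1.trans hdefΔ)
    have h3 : M * (Δ / c) = M / c * Δ := by ring
    have h4 := le_of_abs_le hA1
    have h5 := neg_le_of_abs_le hAa
    nlinarith

/-- For all sufficiently small `ε ≥ 0`, the cubic lattice `ℤ^d` is the unique
minimizer of `L_a ↦ ζ_{L_a}(2p) + ε·ζ^±_{L_a}(2q)` among orthorhombic lattices of
unit covolume. -/
theorem cubic_unique_minimizer_small_eps
    (d : ℕ) (hd : 1 ≤ d) (p q : ℝ) (hq : q > d / 2) (hpq : p > q) :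
    ∃ ε₀ : ℝ, 0 < ε₀ ∧ ∀ ε : ℝ, 0 ≤ ε → ε < ε₀ →
      ∀ a : Fin d → ℝ, (∀ i, 0 < a i) → (∏ i, a i) = 1 → a ≠ (fun _ => 1) →
        (∑' n : {n : Fin d → ℤ // n ≠ 0}, (Qf d a n.1) ^ (-p))
          + ε * ∑' n : {n : Fin d → ℤ // n ≠ 0}, altSign d n.1 * (Qf d a n.1) ^ (-q)
        > (∑' n : {n : Fin d → ℤ // n ≠ 0}, (Qf d (fun _ => 1) n.1) ^ (-p))
          + ε * ∑' n : {n : Fin d → ℤ // n ≠ 0},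
              altSign d n.1 * (Qf d (fun _ => 1) n.1) ^ (-q) := by
  obtain ⟨K, hK, hmain⟩ := exists_alternating_sub_le_mul hd hq hpq
  obtain ⟨c, hc, hlow⟩ := exists_cubicDefect_le hd (lt_trans hq hpq)
  refine ⟨1 / K, by positivity, fun ε hε0 hε a ha hprod hne => ?_⟩
  have h1 := hmain a ha hprod
  have h2 := (mul_pos hc (cubicDefect_pos ha hne)).trans_le (hlow a ha hprod)
  rw [lt_div_iff₀ hK] at hε
  have h3 := mul_le_mul_of_nonneg_left h1 hε0
  have h4 := mul_lt_mul_of_pos_right hε h2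
  rw [one_mul] at h4
  linarith
end
end

section
/- Let p > q > 1 and V > 0. Define, for y > 0, G_V(y) = Σ_{(m,n)∈ℤ²∖{0}} (V(y²m² + y^{−2}n²))^{−p} + Σ_{(m,n)∈ℤ²∖{0}} (−1)^{m+n}(V(y²m² + y^{−2}n²))^{−q}, the alternating-charge energy of the rectangular lattice V^{1/2}(yℤ × y^{−1}ℤ). If 0 < V < V_{p,q} := (S₁(p)/(−S₂(q)))^{1/(p−q)}, then y = 1 is a strict local minimum of G_V on (0,∞). -/
noncomputable section

/-- Alternating-charge inverse-power-law energy of the rectangular lattice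
`V^{1/2}(yℤ × y⁻¹ℤ)`:
`G_V(y) = Σ_{(m,n)≠0} (V(y²m² + y⁻²n²))^{-p} + Σ_{(m,n)≠0} (-1)^{m+n}(V(y²m² + y⁻²n²))^{-q}`. -/
def G (p q V y : ℝ) : ℝ :=
  (∑' x : {x : ℤ × ℤ // x ≠ 0},
      (V * (y ^ 2 * (x.1.1 : ℝ) ^ 2 + (y⁻¹) ^ 2 * (x.1.2 : ℝ) ^ 2)) ^ (-p))
  + ∑' x : {x : ℤ × ℤ // x ≠ 0},
      (-1 : ℝ) ^ (x.1.1 + x.1.2) *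
        (V * (y ^ 2 * (x.1.1 : ℝ) ^ 2 + (y⁻¹) ^ 2 * (x.1.2 : ℝ) ^ 2)) ^ (-q)

/-- `S₁(p) = 4p Σ_{(m,n)≠0} [(p+1)(n²-m²)² - 2m⁴ - 2m²n²]/(m²+n²)^{p+2}`. -/
def S1 (p : ℝ) : ℝ :=
  4 * p * ∑' x : {x : ℤ × ℤ // x ≠ 0},
    ((p + 1) * ((x.1.2 : ℝ) ^ 2 - (x.1.1 : ℝ) ^ 2) ^ 2
        - 2 * (x.1.1 : ℝ) ^ 4 - 2 * (x.1.1 : ℝ) ^ 2 * (x.1.2 : ℝ) ^ 2)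
      / ((x.1.1 : ℝ) ^ 2 + (x.1.2 : ℝ) ^ 2) ^ (p + 2)

/-- `S₂(q) = 4q Σ_{(m,n)≠0} (-1)^{m+n}[(q+1)(n²-m²)² - 2m⁴ - 2m²n²]/(m²+n²)^{q+2}`. -/
def S2 (q : ℝ) : ℝ :=
  4 * q * ∑' x : {x : ℤ × ℤ // x ≠ 0},
    (-1 : ℝ) ^ (x.1.1 + x.1.2) *
      ((q + 1) * ((x.1.2 : ℝ) ^ 2 - (x.1.1 : ℝ) ^ 2) ^ 2
          - 2 * (x.1.1 : ℝ) ^ 4 - 2 * (x.1.1 : ℝ) ^ 2 * (x.1.2 : ℝ) ^ 2)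
      / ((x.1.1 : ℝ) ^ 2 + (x.1.2 : ℝ) ^ 2) ^ (q + 2)

/-- Trapezoidal weighting of the lattice points with `|n| ≤ |m|`: interior points of the vertical
sides of the square shells get weight `2`, corners get weight `1`, all other points weight `0`. -/
def sideWeight (m n : ℤ) : ℝ := 1 + ((SignType.sign (|m| - |n|) : SignType) : ℝ)

lemma sum_sideWeight_mul (M : ℕ) (hM : 0 < M) (g : ℤ → ℝ) :
    ∑ n ∈ Finset.Icc (-(M : ℤ)) M, sideWeight M n * g n =
      ∑ k ∈ Finset.range (2 * M), (g (-(M : ℤ) + k) + g (-(M : ℤ) + (k + 1 : ℕ))) := by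
  have h1 : ∑ k ∈ Finset.range (2 * M), g (-(M : ℤ) + k) =
      ∑ n ∈ Finset.Icc (-(M : ℤ)) M, if n < M then g n else 0 := by
    rw [← Finset.sum_filter]
    refine Finset.sum_bij (fun k _ => -(M : ℤ) + k) ?_ ?_ ?_ ?_
    · intro k hk
      simp only [Finset.mem_range, Finset.mem_filter, Finset.mem_Icc] at hk ⊢
      omega
    · intro a _ b _ h
      simpa using h
    · intro n hn
      simp only [Finset.mem_filter, Finset.mem_Icc] at hn
      exact ⟨(n + M).toNat, by simp only [Finset.mem_range]; omega, by omega⟩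
    · intros; rfl
  have h2 : ∑ k ∈ Finset.range (2 * M), g (-(M : ℤ) + (k + 1 : ℕ)) =
      ∑ n ∈ Finset.Icc (-(M : ℤ)) M, if -(M : ℤ) < n then g n else 0 := by
    rw [← Finset.sum_filter]
    refine Finset.sum_bij (fun k _ => -(M : ℤ) + (k + 1 : ℕ)) ?_ ?_ ?_ ?_
    · intro k hk
      simp only [Finset.mem_range, Finset.mem_filter, Finset.mem_Icc] at hk ⊢
      omega
    · intro a _ b _ h
      simpa using h
    · intro n hn
      simp only [Finset.mem_filter, Finset.mem_Icc] at hn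
      exact ⟨(n + M - 1).toNat, by simp only [Finset.mem_range]; omega, by omega⟩
    · intros; rfl
  rw [Finset.sum_add_distrib, h1, h2, ← Finset.sum_add_distrib]
  refine Finset.sum_congr rfl fun n hn => ?_
  rw [Finset.mem_Icc] at hn
  have habs : |(M : ℤ)| = M := abs_of_nonneg (by positivity)
  unfold sideWeight
  rw [habs]
  rcases eq_or_lt_of_le hn.1 with h | h
  · have : |n| = M := by rw [← h, abs_neg, habs]
    rw [this, if_pos (by omega), if_neg (by omega)]
    simp
  · rcases eq_or_lt_of_le hn.2 with h' | h'
    · have : |n| = M := by rw [h', habs]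
      rw [this, if_neg (by omega), if_pos (by omega)]
      simp
    · have : 0 < (M : ℤ) - |n| := sub_pos.2 (abs_lt.2 ⟨h, h'⟩)
      rw [sign_pos this, if_pos h', if_pos h]
      simp; ring

/-- The angular kernel `cos 4θ / r²` at the point `(a, b)`. -/
def quarticKernel (a b : ℝ) : ℝ :=
  (a ^ 4 - 6 * a ^ 2 * b ^ 2 + b ^ 4) / (a ^ 2 + b ^ 2) ^ 3

/-- The Euler–Maclaurin corrected primitive of `2a/z³ - 1/z²` along vertical unit steps. -/
def kernelPrimitive (a : ℝ) (z : ℂ) : ℂ :=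
  Complex.I * (a / z ^ 2 - a / (2 * z ^ 4) - 1 / z + 1 / (6 * z ^ 3))

lemma quarticKernel_eq_re (a b : ℝ) (ha : 0 < a) :
    quarticKernel a b =
      (2 * a / ((a : ℂ) + b * Complex.I) ^ 3 - 1 / ((a : ℂ) + b * Complex.I) ^ 2).re := by
  have hz : (a : ℂ) + b * Complex.I ≠ 0 := by
    intro h
    have := congrArg Complex.re h
    simp at this
    exact ha.ne' this
  have hw : (a : ℂ) - b * Complex.I ≠ 0 := by
    intro h
    have := congrArg Complex.re h
    simp at this
    exact ha.ne' this
  have hQ : ((a : ℂ) ^ 2 + (b : ℂ) ^ 2) = (a + b * Complex.I) * (a - b * Complex.I) := by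
    ring_nf; simp
  have : (2 * a / ((a : ℂ) + b * Complex.I) ^ 3 - 1 / ((a : ℂ) + b * Complex.I) ^ 2) =
      (((a : ℂ) ^ 4 - 6 * a ^ 2 * b ^ 2 + b ^ 4) / (a ^ 2 + b ^ 2) ^ 3) +
        ((-4 * a ^ 3 * b + 4 * a * b ^ 3) / (a ^ 2 + b ^ 2) ^ 3) * Complex.I := by
    rw [hQ]
    field_simp
    have h2 : Complex.I ^ 2 = -1 := Complex.I_sq
    have h3 : Complex.I ^ 3 = -Complex.I := Complex.I_pow_three
    have h4 : Complex.I ^ 4 = 1 := Complex.I_pow_four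
    ring_nf
    simp only [h2, h3, h4]
    ring
  rw [this]
  unfold quarticKernel
  have e1 : (((a : ℂ) ^ 4 - 6 * a ^ 2 * b ^ 2 + b ^ 4) / (a ^ 2 + b ^ 2) ^ 3) =
    (((a ^ 4 - 6 * a ^ 2 * b ^ 2 + b ^ 4) / (a ^ 2 + b ^ 2) ^ 3 : ℝ) : ℂ) := by push_cast; rfl
  have e2 : ((-4 * (a : ℂ) ^ 3 * b + 4 * a * b ^ 3) / (a ^ 2 + b ^ 2) ^ 3) =
    (((-4 * a ^ 3 * b + 4 * a * b ^ 3) / (a ^ 2 + b ^ 2) ^ 3 : ℝ) : ℂ) := by push_cast; rfl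
  rw [e1, e2, Complex.add_re, Complex.ofReal_re, Complex.re_ofReal_mul]
  simp

/-- The trapezoidal rule for `2a/z³ - 1/z²` on a unit step, as a telescoping difference plus an
error of sixth order. -/
lemma trapezoid_identity (a : ℝ) (z w : ℂ) (hz : z ≠ 0) (hw : w ≠ 0) (h : w = z + Complex.I) :
    (2 * a / z ^ 3 - 1 / z ^ 2) + (2 * a / w ^ 3 - 1 / w ^ 2) =
      2 * (kernelPrimitive a w - kernelPrimitive a z) +
        (1 / (3 * (z * w) ^ 3) - a * (z + w) / (z * w) ^ 4) := by
  have hI : Complex.I = w - z := by rw [h]; ring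
  have hI2 : (w - z) ^ 2 = -1 := by rw [← hI]; exact Complex.I_sq
  have factored : (2 * a / z ^ 3 - 1 / z ^ 2) + (2 * a / w ^ 3 - 1 / w ^ 2) -
      (2 * ((w - z) * (a / w ^ 2 - a / (2 * w ^ 4) - 1 / w + 1 / (6 * w ^ 3)) -
        (w - z) * (a / z ^ 2 - a / (2 * z ^ 4) - 1 / z + 1 / (6 * z ^ 3))) +
        (1 / (3 * (z * w) ^ 3) - a * (z + w) / (z * w) ^ 4)) =
      ((w - z) ^ 2 + 1) * (-2 / (z * w) + ((w - z) ^ 2 - 1) / (3 * (z * w) ^ 3) +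
        2 * a * (z + w) / (z * w) ^ 2 - a * (z + w) * ((w - z) ^ 2 - 1) / (z * w) ^ 4) := by
    field_simp
    ring
  rw [hI2, neg_add_cancel, zero_mul, sub_eq_zero] at factored
  rw [factored, kernelPrimitive, kernelPrimitive, hI]

lemma kernel_trapezoid_lower (a b : ℝ) (ha : 0 < a) :
    2 * ((kernelPrimitive a (a + (b + 1 : ℝ) * Complex.I)).re -
        (kernelPrimitive a (a + b * Complex.I)).re) - 7 / 3 / a ^ 6 ≤
      quarticKernel a b + quarticKernel a (b + 1) := by
  set z : ℂ := a + b * Complex.I with hz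
  set w : ℂ := a + (b + 1 : ℝ) * Complex.I with hw
  have hza : a ≤ ‖z‖ := by
    have := Complex.re_le_norm z
    simpa [hz] using this
  have hwa : a ≤ ‖w‖ := by
    have := Complex.re_le_norm w
    simpa [hw] using this
  have hzp : 0 < ‖z‖ := ha.trans_le hza
  have hwp : 0 < ‖w‖ := ha.trans_le hwa
  have hz0 : z ≠ 0 := norm_pos_iff.1 hzp
  have hw0 : w ≠ 0 := norm_pos_iff.1 hwp
  have key := congrArg Complex.re (trapezoid_identity a z w hz0 hw0 (by
    rw [hw, hz]; push_cast; ring))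
  rw [quarticKernel_eq_re a b ha, quarticKernel_eq_re a (b + 1) ha, ← hz, ← hw, ← Complex.add_re,
    key]
  have hR : ‖1 / (3 * (z * w) ^ 3) - a * (z + w) / (z * w) ^ 4‖ ≤ 7 / 3 / a ^ 6 := by
    have hP : a ^ 2 ≤ ‖z * w‖ := by rw [norm_mul, sq]; gcongr
    have h1 : ‖1 / (3 * (z * w) ^ 3)‖ ≤ 1 / (3 * (a ^ 2) ^ 3) := by
      rw [norm_div, norm_mul, norm_pow]
      simp only [norm_one, Complex.norm_ofNat]
      gcongr
    have h2 : ‖a * (z + w) / (z * w) ^ 4‖ ≤ 2 / (a ^ 2) ^ 3 := by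
      have : a * (z + w) / (z * w) ^ 4 = a * (1 / w + 1 / z) / (z * w) ^ 3 := by
        field_simp
      rw [this, norm_div, norm_mul, norm_pow, Complex.norm_real, Real.norm_of_nonneg ha.le]
      gcongr
      calc a * ‖1 / w + 1 / z‖ ≤ a * (1 / a + 1 / a) := by
            gcongr
            refine (norm_add_le _ _).trans ?_
            rw [norm_div, norm_div, norm_one]
            gcongr
        _ = 2 := by field_simp; norm_num
    calc _ ≤ _ := norm_sub_le _ _
      _ ≤ 1 / (3 * (a ^ 2) ^ 3) + 2 / (a ^ 2) ^ 3 := add_le_add h1 h2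
      _ = _ := by field_simp; norm_num
  have := (abs_le.1 ((Complex.abs_re_le_norm _).trans hR)).1
  simp only [Complex.add_re, Complex.mul_re, Complex.sub_re, Complex.re_ofNat,
    Complex.im_ofNat] at this ⊢
  linarith

lemma kernelPrimitive_re_corner (a : ℝ) (ha : 0 < a) :
    (kernelPrimitive a (a + a * Complex.I)).re = 1 / (24 * a ^ 3) ∧
      (kernelPrimitive a (a + (-a : ℝ) * Complex.I)).re = -(1 / (24 * a ^ 3)) := by
  have ha' : (a : ℂ) ≠ 0 := by exact_mod_cast ha.ne'
  have hI2 : Complex.I ^ 2 = -1 := Complex.I_sq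
  have inv_add : ((a : ℂ) + a * Complex.I)⁻¹ = (1 - Complex.I) / (2 * a) := by
    rw [inv_eq_iff_eq_inv, inv_div, eq_div_iff (by
      intro h; have := congrArg Complex.re h; simp at this)]
    linear_combination -(a : ℂ) * hI2
  have inv_sub : ((a : ℂ) + (-a : ℝ) * Complex.I)⁻¹ = (1 + Complex.I) / (2 * a) := by
    rw [inv_eq_iff_eq_inv, inv_div, eq_div_iff (by
      intro h; have := congrArg Complex.re h; simp at this)]
    push_cast
    linear_combination -(a : ℂ) * hI2
  have expand : ∀ z : ℂ, kernelPrimitive a z = Complex.I *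
      (a * z⁻¹ ^ 2 - a / 2 * z⁻¹ ^ 4 - z⁻¹ + 1 / 6 * z⁻¹ ^ 3) := by
    intro z
    unfold kernelPrimitive
    simp only [div_eq_mul_inv, mul_inv, inv_pow]
    ring
  constructor
  · have : kernelPrimitive a (a + a * Complex.I) =
        ((1 / (24 * a ^ 3) : ℝ) : ℂ) +
          ((1 / (8 * a ^ 3) - 1 / (2 * a) - 1 / (24 * a ^ 3) : ℝ) : ℂ) *
          Complex.I := by
      rw [expand, inv_add]
      push_cast
      field_simp
      have h3 : Complex.I ^ 3 = -Complex.I := Complex.I_pow_three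
      have h4 : Complex.I ^ 4 = 1 := Complex.I_pow_four
      have h5 : Complex.I ^ 5 = Complex.I := by rw [pow_succ, h4, one_mul]
      ring_nf
      simp only [hI2, h3, h4, h5]
      ring
    rw [this, Complex.add_re, Complex.ofReal_re, Complex.re_ofReal_mul]
    simp
  · have : kernelPrimitive a (a + (-a : ℝ) * Complex.I) =
        ((-(1 / (24 * a ^ 3)) : ℝ) : ℂ) +
          ((1 / (8 * a ^ 3) - 1 / (2 * a) - 1 / (24 * a ^ 3) : ℝ) : ℂ) *
          Complex.I := by
      rw [expand, inv_sub]
      push_cast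
      field_simp
      have h3 : Complex.I ^ 3 = -Complex.I := Complex.I_pow_three
      have h4 : Complex.I ^ 4 = 1 := Complex.I_pow_four
      have h5 : Complex.I ^ 5 = Complex.I := by rw [pow_succ, h4, one_mul]
      ring_nf
      simp only [hI2, h3, h4, h5]
      ring
    rw [this, Complex.add_re, Complex.ofReal_re, Complex.re_ofReal_mul]
    simp

lemma sum_quarticKernel_nonneg (M : ℕ) (hM : 0 < M) :
    0 ≤ ∑ n ∈ Finset.Icc (-(M : ℤ)) M, sideWeight M n * quarticKernel M n := by
  rw [sum_sideWeight_mul M hM (fun n => quarticKernel M n)]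
  by_cases h6 : 6 ≤ M
  · have ha : (0 : ℝ) < M := by exact_mod_cast hM
    have h6' : (6 : ℝ) ≤ M := by exact_mod_cast h6
    have step : ∀ k ∈ Finset.range (2 * M),
        2 * ((kernelPrimitive M (M + ((-M + (k + 1 : ℕ) : ℝ) : ℂ) * Complex.I)).re -
          (kernelPrimitive M (M + ((-M + k : ℝ) : ℂ) * Complex.I)).re) - 7 / 3 / (M : ℝ) ^ 6 ≤
        quarticKernel M ((-(M : ℤ) + k : ℤ)) + quarticKernel M ((-(M : ℤ) + (k + 1 : ℕ) : ℤ)) := by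
      intro k _
      have := kernel_trapezoid_lower M (-M + k) ha
      push_cast at this ⊢
      simpa only [add_assoc] using this
    refine le_trans ?_ (Finset.sum_le_sum step)
    rw [Finset.sum_sub_distrib, ← Finset.mul_sum,
      Finset.sum_range_sub (fun k : ℕ =>
        (kernelPrimitive M (M + ((-M + k : ℝ) : ℂ) * Complex.I)).re)]
    obtain ⟨c1, c2⟩ := kernelPrimitive_re_corner M ha
    have e : ((-M + (2 * M : ℕ) : ℝ)) = M := by push_cast; ring
    have e0 : ((-M + (0 : ℕ) : ℝ)) = -M := by simp
    rw [e, e0]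
    simp only [Complex.ofReal_natCast] at c1 c2 ⊢
    rw [c1, c2]
    simp only [Finset.sum_const, Finset.card_range, nsmul_eq_mul]
    push_cast
    have : 2 * (1 / (24 * (M : ℝ) ^ 3) - -(1 / (24 * (M : ℝ) ^ 3))) - 2 * M * (7 / 3 / (M : ℝ) ^ 6)
        = ((M : ℝ) ^ 2 - 28) / (6 * M ^ 5) := by
      field_simp; ring
    rw [this]
    have : (0 : ℝ) ≤ (M : ℝ) ^ 2 - 28 := by nlinarith
    positivity
  · interval_cases M <;>
      simp only [Finset.sum_range_succ, Finset.sum_range_zero, quarticKernel] <;> norm_num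

/-- Up to the factor `4p`, the second derivative at `t = 0` of `(e^{2t}a² + e^{-2t}b²)^{-p}`. -/
def hessianTerm (p a b : ℝ) : ℝ :=
  ((p + 1) * (b ^ 2 - a ^ 2) ^ 2 - (a ^ 2 + b ^ 2) ^ 2) / (a ^ 2 + b ^ 2) ^ (p + 2)

lemma hessianTerm_swap (p a b : ℝ) : hessianTerm p b a = hessianTerm p a b := by
  unfold hessianTerm
  rw [add_comm (b ^ 2), show (a ^ 2 - b ^ 2) ^ 2 = (b ^ 2 - a ^ 2) ^ 2 by ring]

lemma exists_mul_quarticKernel_le_hessianTerm (p a : ℝ) (hp : 1 < p) (ha : 0 < a) :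
    ∃ w : ℝ, 0 < w ∧ (∀ b, |b| ≤ a → w * quarticKernel a b ≤ hessianTerm p a b) ∧
      w * quarticKernel a 0 < hessianTerm p a 0 := by
  set c := √(p + 1) with hc
  have hc0 : 0 < c := Real.sqrt_pos.2 (by linarith)
  have hc2 : c ^ 2 = p + 1 := Real.sq_sqrt (by linarith)
  set Q₀ := 2 * a ^ 2 * c / (1 + c) with hQ₀
  have hQ₀pos : 0 < Q₀ := by positivity
  have hw : 0 < Q₀ ^ (-(p - 1)) := Real.rpow_pos_of_pos hQ₀pos _
  have factor : ∀ b, hessianTerm p a b = (a ^ 2 + b ^ 2) ^ (-(p - 1)) *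
      (((p + 1) * (b ^ 2 - a ^ 2) ^ 2 - (a ^ 2 + b ^ 2) ^ 2) / (a ^ 2 + b ^ 2) ^ 3) := by
    intro b
    have hQ : 0 < a ^ 2 + b ^ 2 := by positivity
    unfold hessianTerm
    rw [show p + 2 = (p - 1) + (3 : ℕ) by push_cast; ring, Real.rpow_add_natCast hQ.ne',
      Real.rpow_neg hQ.le]
    field_simp
  have compare : ∀ b, |b| ≤ a → Q₀ ^ (-(p - 1)) *
      (((p + 1) * (b ^ 2 - a ^ 2) ^ 2 - (a ^ 2 + b ^ 2) ^ 2) / (a ^ 2 + b ^ 2) ^ 3) ≤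
      hessianTerm p a b := by
    intro b hb
    have hQ : 0 < a ^ 2 + b ^ 2 := by positivity
    have hba : b ^ 2 ≤ a ^ 2 := by
      rw [← sq_abs b]; gcongr
    rw [factor b]
    rcases le_total (a ^ 2 + b ^ 2) Q₀ with h | h
    · refine mul_le_mul_of_nonneg_right
        (Real.rpow_le_rpow_of_nonpos hQ h (by linarith)) (div_nonneg ?_ (by positivity))
      rw [hQ₀, le_div_iff₀ (by positivity)] at h
      have h1 : a ^ 2 + b ^ 2 ≤ c * (a ^ 2 - b ^ 2) := by nlinarith
      have h2 := pow_le_pow_left₀ hQ.le h1 2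
      rw [← hc2]
      nlinarith
    · refine mul_le_mul_of_nonpos_right
        (Real.rpow_le_rpow_of_nonpos hQ₀pos h (by linarith))
        (div_nonpos_of_nonpos_of_nonneg ?_ (by positivity))
      rw [hQ₀, div_le_iff₀ (by positivity)] at h
      have h1 : c * (a ^ 2 - b ^ 2) ≤ a ^ 2 + b ^ 2 := by nlinarith
      have h2 := pow_le_pow_left₀ (mul_nonneg hc0.le (sub_nonneg.2 hba)) h1 2
      rw [← hc2]
      nlinarith
  refine ⟨Q₀ ^ (-(p - 1)), hw, fun b hb => le_trans ?_ (compare b hb),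
    lt_of_lt_of_le ?_ (compare 0 (by simpa using ha.le))⟩
  · unfold quarticKernel
    have hQ : 0 < a ^ 2 + b ^ 2 := by positivity
    gcongr
    nlinarith [mul_nonneg (sub_nonneg.2 hp.le) (sq_nonneg (b ^ 2 - a ^ 2))]
  · unfold quarticKernel
    gcongr
    nlinarith [mul_pos (sub_pos.2 hp) (pow_pos ha 4)]

lemma abs_cast_sign_le_one (k : ℤ) : |((SignType.sign k : SignType) : ℝ)| ≤ 1 := by
  rcases lt_trichotomy k 0 with h | h | h
  · simp [sign_neg h]
  · simp [h]
  · simp [sign_pos h]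

lemma sideWeight_nonneg (m n : ℤ) : 0 ≤ sideWeight m n := by
  have := (abs_le.1 (abs_cast_sign_le_one (|m| - |n|))).1
  unfold sideWeight
  linarith

lemma sum_hessianTerm_pos (p : ℝ) (hp : 1 < p) (M : ℕ) (hM : 0 < M) :
    0 < ∑ n ∈ Finset.Icc (-(M : ℤ)) M, sideWeight M n * hessianTerm p M n := by
  have ha : (0 : ℝ) < M := by exact_mod_cast hM
  obtain ⟨w, hw, hle, hlt⟩ := exists_mul_quarticKernel_le_hessianTerm p M hp ha
  refine lt_of_le_of_lt (mul_nonneg hw.le (sum_quarticKernel_nonneg M hM)) ?_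
  rw [Finset.mul_sum]
  refine Finset.sum_lt_sum (fun n hn => ?_) ⟨0, by simp, ?_⟩
  · have hn' : |(n : ℝ)| ≤ M := by
      rw [Finset.mem_Icc] at hn
      exact_mod_cast abs_le.2 hn
    rw [mul_left_comm]
    exact mul_le_mul_of_nonneg_left (hle n hn') (sideWeight_nonneg _ _)
  · have hs : 0 < sideWeight M 0 := by
      have : 0 < |(M : ℤ)| - |0| := by simpa using hM
      rw [sideWeight, sign_pos this]
      simp
    rw [mul_left_comm]
    simpa using mul_lt_mul_of_pos_left hlt hs

lemma summable_sq_add_sq_rpow_neg (s : ℝ) (hs : 1 < s) :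
    Summable fun x : ℤ × ℤ => ((x.1 : ℝ) ^ 2 + (x.2 : ℝ) ^ 2) ^ (-s) := by
  have h := (finTwoArrowEquiv ℤ).symm.summable_iff.2
    (EisensteinSeries.summable_one_div_norm_rpow (k := 2 * s) (by linarith))
  refine h.of_nonneg_of_le (fun x => by positivity) fun x => ?_
  simp only [Function.comp_apply]
  set v := (finTwoArrowEquiv ℤ).symm x with hv
  by_cases hx : x = 0
  · subst hx
    simp only [Prod.fst_zero, Prod.snd_zero]
    rw [show ((0 : ℤ) : ℝ) ^ 2 + ((0 : ℤ) : ℝ) ^ 2 = 0 by simp, Real.zero_rpow (by linarith)]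
    positivity
  · have hv0 : v ≠ 0 := by
      intro h0
      apply hx
      have e0 := congrFun h0 0
      have e1 := congrFun h0 1
      simp [hv] at e0 e1
      exact Prod.ext e0 e1
    have hvp : 0 < ‖v‖ := norm_pos_iff.2 hv0
    have hle : ‖v‖ ^ 2 ≤ (x.1 : ℝ) ^ 2 + (x.2 : ℝ) ^ 2 := by
      have : ‖v‖ ≤ √((x.1 : ℝ) ^ 2 + (x.2 : ℝ) ^ 2) := by
        rw [pi_norm_le_iff_of_nonneg (Real.sqrt_nonneg _)]
        intro i
        rw [Int.norm_eq_abs]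
        apply Real.abs_le_sqrt
        fin_cases i
        · simp [hv]; positivity
        · simp [hv]; positivity
      calc ‖v‖ ^ 2 ≤ √((x.1 : ℝ) ^ 2 + (x.2 : ℝ) ^ 2) ^ 2 := by gcongr
        _ = _ := Real.sq_sqrt (by positivity)
    calc ((x.1 : ℝ) ^ 2 + (x.2 : ℝ) ^ 2) ^ (-s) ≤ (‖v‖ ^ 2) ^ (-s) :=
          Real.rpow_le_rpow_of_nonpos (by positivity) hle (by linarith)
      _ = ‖v‖ ^ (-(2 * s)) := by
          rw [← Real.rpow_natCast ‖v‖ 2, ← Real.rpow_mul hvp.le]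
          congr 1
          push_cast; ring

lemma summable_of_abs_le_rpow_neg {s C : ℝ} (hs : 1 < s) {F : ℤ × ℤ → ℝ}
    (h : ∀ x, |F x| ≤ C * ((x.1 : ℝ) ^ 2 + (x.2 : ℝ) ^ 2) ^ (-s)) : Summable F :=
  .of_norm_bounded ((summable_sq_add_sq_rpow_neg s hs).mul_left C) h

lemma tsum_eq_zero_of_antisymm {F : ℤ × ℤ → ℝ} (h : ∀ m n, F (n, m) = -F (m, n)) :
    ∑' x, F x = 0 := by
  have h1 : ∑' x, F x = ∑' x, F (Prod.swap x) :=
    ((Equiv.prodComm ℤ ℤ).tsum_eq F).symm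
  have h2 : ∑' x, F (Prod.swap x) = -∑' x, F x := by
    rw [← tsum_neg]
    exact tsum_congr fun x => h x.1 x.2
  linarith

/-- A numerator of size `O(Q²)` over `Q^{s+2}` is `O(Q^{-s})`. -/
lemma abs_div_rpow_le {s C N Q : ℝ} (hs : 1 < s) (hQ : 0 ≤ Q) (hN : |N| ≤ C * Q ^ 2) :
    |N / Q ^ (s + 2)| ≤ C * Q ^ (-s) := by
  rcases hQ.eq_or_lt with h | h
  · rw [← h, Real.zero_rpow (by linarith), Real.zero_rpow (by linarith)]
    simp
  · rw [abs_div, abs_of_pos (Real.rpow_pos_of_pos h _), div_le_iff₀ (Real.rpow_pos_of_pos h _),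
      mul_assoc, ← Real.rpow_add h, show -s + (s + 2) = ((2 : ℕ) : ℝ) by push_cast; ring,
      Real.rpow_natCast]
    exact hN

lemma abs_hessianTerm_le {s : ℝ} (hs : 1 < s) (a b : ℝ) :
    |hessianTerm s a b| ≤ (s + 2) * (a ^ 2 + b ^ 2) ^ (-s) := by
  refine abs_div_rpow_le hs (by positivity) ?_
  rw [abs_le]
  have h1 : (b ^ 2 - a ^ 2) ^ 2 ≤ (a ^ 2 + b ^ 2) ^ 2 := by nlinarith [sq_nonneg (a * b)]
  constructor
  · nlinarith [mul_nonneg (by linarith : 0 ≤ s + 1) (sq_nonneg (b ^ 2 - a ^ 2)),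
      sq_nonneg (a ^ 2 + b ^ 2)]
  · nlinarith [mul_le_mul_of_nonneg_left h1 (by linarith : 0 ≤ s + 1), sq_nonneg (a ^ 2 + b ^ 2)]

lemma tsum_hessianTerm_pos (p : ℝ) (hp : 1 < p) :
    0 < ∑' x : ℤ × ℤ, hessianTerm p x.1 x.2 := by
  have sum1 : Summable fun x : ℤ × ℤ => hessianTerm p x.1 x.2 :=
    summable_of_abs_le_rpow_neg hp fun x => abs_hessianTerm_le hp _ _
  have sum2 : Summable fun x : ℤ × ℤ =>
      ((SignType.sign (|x.1| - |x.2|) : SignType) : ℝ) * hessianTerm p x.1 x.2 :=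
    summable_of_abs_le_rpow_neg hp fun x => by
      rw [abs_mul]
      exact (mul_le_of_le_one_left (abs_nonneg _) (abs_cast_sign_le_one _)).trans
        (abs_hessianTerm_le hp _ _)
  have zero : ∑' x : ℤ × ℤ,
      ((SignType.sign (|x.1| - |x.2|) : SignType) : ℝ) * hessianTerm p x.1 x.2 = 0 := by
    refine tsum_eq_zero_of_antisymm fun m n => ?_
    simp only
    rw [hessianTerm_swap, ← neg_sub |m| |n|, Left.sign_neg]
    simp
  have split : ∀ x : ℤ × ℤ, sideWeight x.1 x.2 * hessianTerm p x.1 x.2 = hessianTerm p x.1 x.2 +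
      ((SignType.sign (|x.1| - |x.2|) : SignType) : ℝ) * hessianTerm p x.1 x.2 := by
    intro x; unfold sideWeight; ring
  have sumW : Summable fun x : ℤ × ℤ => sideWeight x.1 x.2 * hessianTerm p x.1 x.2 := by
    simp_rw [split]; exact sum1.add sum2
  have eq : ∑' x : ℤ × ℤ, hessianTerm p x.1 x.2 =
      ∑' x : ℤ × ℤ, sideWeight x.1 x.2 * hessianTerm p x.1 x.2 := by
    simp_rw [split]
    rw [sum1.tsum_add sum2, zero, add_zero]
  have outside : ∀ m n : ℤ, n ∉ Finset.Icc (-(m.natAbs : ℤ)) m.natAbs → sideWeight m n = 0 := by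
    intro m n hn
    have : |m| - |n| < 0 := by
      rw [Finset.mem_Icc, ← abs_le, Int.natCast_natAbs] at hn
      linarith
    unfold sideWeight
    simp [sign_neg this]
  have rows : ∀ m : ℤ, m ≠ 0 → 0 < ∑' n : ℤ, sideWeight m n * hessianTerm p m n := by
    intro m hm
    rw [tsum_eq_sum (s := Finset.Icc (-(m.natAbs : ℤ)) m.natAbs) fun n hn => by
      rw [outside m n hn, zero_mul]]
    convert sum_hessianTerm_pos p hp m.natAbs (Int.natAbs_pos.2 hm) using 3 with n
    · unfold sideWeight; simp
    · unfold hessianTerm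
      rw [Nat.cast_natAbs]
      simp
  have row_zero : ∑' n : ℤ, sideWeight 0 n * hessianTerm p ((0 : ℤ) : ℝ) n = 0 := by
    refine (tsum_congr fun n => ?_).trans tsum_zero
    by_cases hn : n = 0
    · subst hn; simp [hessianTerm]
    · rw [outside 0 n (by simp; omega), zero_mul]
  rw [eq, sumW.tsum_prod]
  refine sumW.prod.tsum_pos (fun m => ?_) 1 (rows 1 one_ne_zero)
  rcases eq_or_ne m 0 with h | h
  · subst h; exact row_zero.ge
  · exact (rows m h).le

/-- The squared length `e^{2t}m² + e^{-2t}n²` of a point of the stretched lattice. -/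
def stretchedForm (t : ℝ) (x : ℤ × ℤ) : ℝ :=
  Real.exp (2 * t) * (x.1 : ℝ) ^ 2 + Real.exp (-(2 * t)) * (x.2 : ℝ) ^ 2

/-- Half the derivative of `stretchedForm` in `t`. -/
def stretchedDiff (t : ℝ) (x : ℤ × ℤ) : ℝ :=
  Real.exp (2 * t) * (x.1 : ℝ) ^ 2 - Real.exp (-(2 * t)) * (x.2 : ℝ) ^ 2

/-- The energy of the stretched lattice with charges `ε` and exponent `s`. -/
def stretchedEnergy (ε : ℤ × ℤ → ℝ) (s t : ℝ) : ℝ :=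
  ∑' x, ε x * stretchedForm t x ^ (-s)

/-- The termwise derivative of `stretchedEnergy` in `t`. -/
def stretchedEnergyDeriv (ε : ℤ × ℤ → ℝ) (s t : ℝ) : ℝ :=
  ∑' x, ε x * (-(2 * s) * (stretchedDiff t x * stretchedForm t x ^ (-s - 1)))

/-- The termwise second derivative of `stretchedEnergy` in `t`. -/
def stretchedEnergyDeriv₂ (ε : ℤ × ℤ → ℝ) (s t : ℝ) : ℝ :=
  ∑' x, ε x * (4 * s * (((s + 1) * stretchedDiff t x ^ 2 - stretchedForm t x ^ 2) /
    stretchedForm t x ^ (s + 2)))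

lemma stretchedForm_nonneg (t : ℝ) (x : ℤ × ℤ) : 0 ≤ stretchedForm t x := by
  unfold stretchedForm; positivity

lemma stretchedForm_pos (t : ℝ) {x : ℤ × ℤ} (hx : x ≠ 0) : 0 < stretchedForm t x := by
  unfold stretchedForm
  by_cases h : x.1 = 0
  · have h2 : x.2 ≠ 0 := fun h2 => hx (Prod.ext h h2)
    have : (x.2 : ℝ) ≠ 0 := by exact_mod_cast h2
    positivity
  · have : (x.1 : ℝ) ≠ 0 := by exact_mod_cast h
    positivity

lemma stretchedForm_at_zero (x : ℤ × ℤ) :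
    stretchedForm 0 x = (x.1 : ℝ) ^ 2 + (x.2 : ℝ) ^ 2 := by
  simp [stretchedForm]

lemma abs_stretchedDiff_le (t : ℝ) (x : ℤ × ℤ) : |stretchedDiff t x| ≤ stretchedForm t x := by
  unfold stretchedDiff stretchedForm
  have h1 : 0 ≤ Real.exp (2 * t) * (x.1 : ℝ) ^ 2 := by positivity
  have h2 : 0 ≤ Real.exp (-(2 * t)) * (x.2 : ℝ) ^ 2 := by positivity
  rw [abs_le]; constructor <;> linarith

lemma stretchedForm_rpow_neg_le {s t : ℝ} (hs : 1 < s) (ht : t ∈ Set.Ioo (-1 : ℝ) 1) (x : ℤ × ℤ) :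
    stretchedForm t x ^ (-s) ≤
      Real.exp (-2) ^ (-s) * ((x.1 : ℝ) ^ 2 + (x.2 : ℝ) ^ 2) ^ (-s) := by
  rcases eq_or_ne x 0 with h | h
  · subst h
    have : (0 : ℝ) ^ (-s) = 0 := Real.zero_rpow (by linarith)
    simp [stretchedForm, this]
  · rw [← Real.mul_rpow (Real.exp_pos _).le (by positivity)]
    refine Real.rpow_le_rpow_of_nonpos ?_ ?_ (by linarith)
    · rw [← stretchedForm_at_zero]
      exact mul_pos (Real.exp_pos _) (stretchedForm_pos 0 h)
    · unfold stretchedForm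
      rw [mul_add]
      have h1 : -2 ≤ 2 * t := by linarith [ht.1]
      have h2 : -2 ≤ -(2 * t) := by linarith [ht.2]
      gcongr

lemma hasDerivAt_stretchedForm (t : ℝ) (x : ℤ × ℤ) :
    HasDerivAt (fun t => stretchedForm t x) (2 * stretchedDiff t x) t := by
  have h1 : HasDerivAt (fun t : ℝ => 2 * t) 2 t := by
    simpa using (hasDerivAt_id t).const_mul (2 : ℝ)
  convert! (h1.exp.mul_const ((x.1 : ℝ) ^ 2)).add (h1.neg.exp.mul_const ((x.2 : ℝ) ^ 2)) using 1
  unfold stretchedDiff; simp; ring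

lemma hasDerivAt_stretchedDiff (t : ℝ) (x : ℤ × ℤ) :
    HasDerivAt (fun t => stretchedDiff t x) (2 * stretchedForm t x) t := by
  have h1 : HasDerivAt (fun t : ℝ => 2 * t) 2 t := by
    simpa using (hasDerivAt_id t).const_mul (2 : ℝ)
  convert! (h1.exp.mul_const ((x.1 : ℝ) ^ 2)).sub (h1.neg.exp.mul_const ((x.2 : ℝ) ^ 2)) using 1
  unfold stretchedForm; simp; ring

lemma hasDerivAt_stretchedForm_rpow (s t : ℝ) (x : ℤ × ℤ) :
    HasDerivAt (fun t => stretchedForm t x ^ (-s))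
      (-(2 * s) * (stretchedDiff t x * stretchedForm t x ^ (-s - 1))) t := by
  rcases eq_or_ne x 0 with h | h
  · subst h
    simpa [stretchedForm, stretchedDiff] using hasDerivAt_const t ((0 : ℝ) ^ (-s))
  · convert! (hasDerivAt_stretchedForm t x).rpow_const (p := -s)
      (Or.inl (stretchedForm_pos t h).ne') using 1
    ring

lemma hasDerivAt_stretchedForm_rpow_deriv (s t : ℝ) (x : ℤ × ℤ) :
    HasDerivAt (fun t => -(2 * s) * (stretchedDiff t x * stretchedForm t x ^ (-s - 1)))
      (4 * s * (((s + 1) * stretchedDiff t x ^ 2 - stretchedForm t x ^ 2) /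
        stretchedForm t x ^ (s + 2))) t := by
  rcases eq_or_ne x 0 with h | h
  · subst h
    simpa [stretchedForm, stretchedDiff] using hasDerivAt_const t (0 : ℝ)
  · have hQ := stretchedForm_pos t h
    convert! ((hasDerivAt_stretchedDiff t x).mul
      ((hasDerivAt_stretchedForm t x).rpow_const (p := -s - 1) (Or.inl hQ.ne'))).const_mul
        (-(2 * s)) using 1
    have e1 : stretchedForm t x ^ (-s - 1) =
        stretchedForm t x / stretchedForm t x ^ (s + 2) := by
      rw [show -s - 1 = 1 - (s + 2) by ring, Real.rpow_sub hQ, Real.rpow_one]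
    have e2 : stretchedForm t x ^ (-s - 1 - 1) = 1 / stretchedForm t x ^ (s + 2) := by
      rw [show -s - 1 - 1 = -(s + 2) by ring, Real.rpow_neg hQ.le, one_div]
    rw [e1, e2]
    ring

lemma abs_stretchedForm_rpow_deriv_le {s t : ℝ} (hs : 1 < s) (x : ℤ × ℤ) :
    |-(2 * s) * (stretchedDiff t x * stretchedForm t x ^ (-s - 1))| ≤
      2 * s * stretchedForm t x ^ (-s) := by
  rw [abs_mul, abs_neg, abs_of_pos (by linarith : 0 < 2 * s), abs_mul,
    abs_of_nonneg (Real.rpow_nonneg (stretchedForm_nonneg t x) _)]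
  refine mul_le_mul_of_nonneg_left ?_ (by linarith)
  calc _ ≤ stretchedForm t x * stretchedForm t x ^ (-s - 1) :=
        mul_le_mul_of_nonneg_right (abs_stretchedDiff_le t x)
          (Real.rpow_nonneg (stretchedForm_nonneg t x) _)
    _ = stretchedForm t x ^ (-s) := by
        rw [mul_comm, ← Real.rpow_add_one' (stretchedForm_nonneg t x) (by linarith),
          sub_add_cancel]

lemma abs_stretchedForm_rpow_deriv₂_le {s t : ℝ} (hs : 1 < s) (x : ℤ × ℤ) :
    |4 * s * (((s + 1) * stretchedDiff t x ^ 2 - stretchedForm t x ^ 2) /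
        stretchedForm t x ^ (s + 2))| ≤ 4 * s * (s + 2) * stretchedForm t x ^ (-s) := by
  rw [abs_mul, abs_of_pos (by linarith : 0 < 4 * s), mul_assoc (4 * s)]
  refine mul_le_mul_of_nonneg_left
    (abs_div_rpow_le hs (stretchedForm_nonneg t x) ?_) (by linarith)
  have h1 : stretchedDiff t x ^ 2 ≤ stretchedForm t x ^ 2 :=
    sq_le_sq.2 ((abs_stretchedDiff_le t x).trans (le_abs_self _))
  have h2 := mul_le_mul_of_nonneg_left h1 (by linarith : 0 ≤ s + 1)
  have h3 := mul_nonneg (by linarith : 0 ≤ s + 1) (sq_nonneg (stretchedDiff t x))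
  have h4 := mul_nonneg (by linarith : 0 ≤ s + 1) (sq_nonneg (stretchedForm t x))
  rw [abs_le]
  constructor <;> nlinarith [sq_nonneg (stretchedForm t x)]

section Energy

variable {ε : ℤ × ℤ → ℝ} (hε : ∀ x, |ε x| ≤ 1) {s : ℝ} (hs : 1 < s)
include hε hs

lemma abs_weighted_le {C A t : ℝ} (hC : 0 ≤ C) (ht : t ∈ Set.Ioo (-1 : ℝ) 1) (x : ℤ × ℤ)
    (hA : |A| ≤ C * stretchedForm t x ^ (-s)) :
    |ε x * A| ≤ C * Real.exp (-2) ^ (-s) * ((x.1 : ℝ) ^ 2 + (x.2 : ℝ) ^ 2) ^ (-s) := by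
  rw [abs_mul, mul_assoc]
  exact ((mul_le_of_le_one_left (abs_nonneg _) (hε x)).trans hA).trans
    (mul_le_mul_of_nonneg_left (stretchedForm_rpow_neg_le hs ht x) hC)

lemma hasDerivAt_stretchedEnergy {t : ℝ} (ht : t ∈ Set.Ioo (-1 : ℝ) 1) :
    HasDerivAt (stretchedEnergy ε s) (stretchedEnergyDeriv ε s t) t := by
  refine hasDerivAt_tsum_of_isPreconnected
    ((summable_sq_add_sq_rpow_neg s hs).mul_left (2 * s * Real.exp (-2) ^ (-s)))
    isOpen_Ioo isPreconnected_Ioo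
    (fun x t _ => (hasDerivAt_stretchedForm_rpow s t x).const_mul (ε x))
    (fun x t ht => abs_weighted_le hε hs (by linarith) ht x
      (abs_stretchedForm_rpow_deriv_le hs x)) ht
    (summable_of_abs_le_rpow_neg hs fun x => abs_weighted_le hε hs zero_le_one ht x ?_) ht
  rw [one_mul, abs_of_nonneg (Real.rpow_nonneg (stretchedForm_nonneg t x) _)]

lemma hasDerivAt_stretchedEnergyDeriv {t : ℝ} (ht : t ∈ Set.Ioo (-1 : ℝ) 1) :
    HasDerivAt (stretchedEnergyDeriv ε s) (stretchedEnergyDeriv₂ ε s t) t :=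
  hasDerivAt_tsum_of_isPreconnected
    ((summable_sq_add_sq_rpow_neg s hs).mul_left (4 * s * (s + 2) * Real.exp (-2) ^ (-s)))
    isOpen_Ioo isPreconnected_Ioo
    (fun x t _ => (hasDerivAt_stretchedForm_rpow_deriv s t x).const_mul (ε x))
    (fun x t ht => abs_weighted_le hε hs
      (mul_nonneg (by linarith) (by linarith)) ht x
      (abs_stretchedForm_rpow_deriv₂_le hs x)) ht
    (summable_of_abs_le_rpow_neg hs fun x => abs_weighted_le hε hs (by linarith) ht x
      (abs_stretchedForm_rpow_deriv_le hs x)) ht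

variable (hsymm : ∀ m n, ε (n, m) = ε (m, n))
include hsymm

/-- The defining sums of `S1` and `S2` agree with the symmetrised Hessian sums. -/
lemma tsum_ne_zero_eq_tsum_hessianTerm :
    ∑' x : {x : ℤ × ℤ // x ≠ 0},
      ε x.1 * ((s + 1) * ((x.1.2 : ℝ) ^ 2 - (x.1.1 : ℝ) ^ 2) ^ 2
          - 2 * (x.1.1 : ℝ) ^ 4 - 2 * (x.1.1 : ℝ) ^ 2 * (x.1.2 : ℝ) ^ 2)
        / ((x.1.1 : ℝ) ^ 2 + (x.1.2 : ℝ) ^ 2) ^ (s + 2) =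
      ∑' x : ℤ × ℤ, ε x * hessianTerm s x.1 x.2 := by
  have h := tsum_subtype_eq_of_support_subset (s := {x : ℤ × ℤ | x ≠ 0})
    (f := fun x : ℤ × ℤ => ε x * ((s + 1) * ((x.2 : ℝ) ^ 2 - (x.1 : ℝ) ^ 2) ^ 2
          - 2 * (x.1 : ℝ) ^ 4 - 2 * (x.1 : ℝ) ^ 2 * (x.2 : ℝ) ^ 2)
        / ((x.1 : ℝ) ^ 2 + (x.2 : ℝ) ^ 2) ^ (s + 2)) (by
      rintro x hx rfl
      simp at hx)
  refine h.trans ?_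
  have split : ∀ x : ℤ × ℤ, ε x * ((s + 1) * ((x.2 : ℝ) ^ 2 - (x.1 : ℝ) ^ 2) ^ 2
          - 2 * (x.1 : ℝ) ^ 4 - 2 * (x.1 : ℝ) ^ 2 * (x.2 : ℝ) ^ 2)
        / ((x.1 : ℝ) ^ 2 + (x.2 : ℝ) ^ 2) ^ (s + 2) =
      ε x * hessianTerm s x.1 x.2 +
      ε x * (((x.2 : ℝ) ^ 4 - (x.1 : ℝ) ^ 4) / ((x.1 : ℝ) ^ 2 + (x.2 : ℝ) ^ 2) ^ (s + 2)) := by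
    intro x; unfold hessianTerm; ring
  simp_rw [split]
  have sum1 : Summable fun x : ℤ × ℤ => ε x * hessianTerm s x.1 x.2 :=
    summable_of_abs_le_rpow_neg hs fun x => by
      rw [abs_mul]
      exact (mul_le_of_le_one_left (abs_nonneg _) (hε x)).trans (abs_hessianTerm_le hs _ _)
  have sum2 : Summable fun x : ℤ × ℤ => ε x *
      (((x.2 : ℝ) ^ 4 - (x.1 : ℝ) ^ 4) / ((x.1 : ℝ) ^ 2 + (x.2 : ℝ) ^ 2) ^ (s + 2)) :=
    summable_of_abs_le_rpow_neg (C := 1) hs fun x => by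
      rw [abs_mul]
      refine (mul_le_of_le_one_left (abs_nonneg _) (hε x)).trans
        (abs_div_rpow_le hs (by positivity) ?_)
      have h1 : 0 ≤ (x.1 : ℝ) ^ 2 * (x.2 : ℝ) ^ 2 := by positivity
      have h2 : 0 ≤ (x.1 : ℝ) ^ 4 := by positivity
      have h3 : 0 ≤ (x.2 : ℝ) ^ 4 := by positivity
      rw [abs_le]
      constructor <;> nlinarith
  rw [sum1.tsum_add sum2, add_eq_left]
  refine tsum_eq_zero_of_antisymm fun m n => ?_
  simp only
  rw [hsymm m n, add_comm ((n : ℝ) ^ 2)]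
  ring

omit hε hs in
lemma stretchedEnergyDeriv_zero : stretchedEnergyDeriv ε s 0 = 0 := by
  refine tsum_eq_zero_of_antisymm fun m n => ?_
  simp only [stretchedForm, stretchedDiff, mul_zero, neg_zero, Real.exp_zero, one_mul]
  rw [hsymm m n, add_comm ((n : ℝ) ^ 2)]
  ring

omit hε hs hsymm in
lemma stretchedEnergyDeriv₂_zero :
    stretchedEnergyDeriv₂ ε s 0 = 4 * s * ∑' x : ℤ × ℤ, ε x * hessianTerm s x.1 x.2 := by
  rw [← tsum_mul_left]
  refine tsum_congr fun x => ?_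
  simp only [stretchedForm, stretchedDiff, mul_zero, neg_zero, Real.exp_zero, one_mul, hessianTerm]
  rw [show ((x.1 : ℝ) ^ 2 - (x.2 : ℝ) ^ 2) ^ 2 = ((x.2 : ℝ) ^ 2 - (x.1 : ℝ) ^ 2) ^ 2 by ring]
  ring

omit hε hsymm in
lemma tsum_ne_zero_eq_stretchedEnergy {V : ℝ} (hV : 0 < V) (t : ℝ) :
    ∑' x : {x : ℤ × ℤ // x ≠ 0}, ε x.1 * (V * (Real.exp t ^ 2 * (x.1.1 : ℝ) ^ 2 +
      ((Real.exp t)⁻¹) ^ 2 * (x.1.2 : ℝ) ^ 2)) ^ (-s) = V ^ (-s) * stretchedEnergy ε s t := by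
  have h := tsum_subtype_eq_of_support_subset (s := {x : ℤ × ℤ | x ≠ 0})
    (f := fun x : ℤ × ℤ => ε x * (V * (Real.exp t ^ 2 * (x.1 : ℝ) ^ 2 +
      ((Real.exp t)⁻¹) ^ 2 * (x.2 : ℝ) ^ 2)) ^ (-s)) (by
      rintro x hx rfl
      simp [Real.zero_rpow (by linarith : -s ≠ 0)] at hx)
  refine h.trans ?_
  rw [stretchedEnergy, ← tsum_mul_left]
  refine tsum_congr fun x => ?_
  have e1 : Real.exp t ^ 2 = Real.exp (2 * t) := by rw [← Real.exp_nat_mul]; norm_num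
  have e2 : (Real.exp t)⁻¹ ^ 2 = Real.exp (-(2 * t)) := by rw [inv_pow, e1, Real.exp_neg]
  rw [e1, e2]
  change ε x * (V * stretchedForm t x) ^ (-s) = _
  rw [Real.mul_rpow hV.le (stretchedForm_nonneg t x)]
  ring

end Energy

/-- Strict version of the second derivative test. -/
lemma eventually_lt_of_deriv₂_pos {f f' : ℝ → ℝ} {c x₀ : ℝ}
    (hf : ∀ᶠ x in nhds x₀, HasDerivAt f (f' x) x) (hf' : HasDerivAt f' c x₀)
    (h0 : f' x₀ = 0) (hc : 0 < c) :
    ∀ᶠ x in nhdsWithin x₀ {x₀}ᶜ, f x₀ < f x := by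
  set g : ℝ → ℝ := fun x => f x - c / 4 * (x - x₀) ^ 2 with hg
  have hsq : ∀ x, HasDerivAt (fun x => c / 4 * (x - x₀) ^ 2) (c / 2 * (x - x₀)) x := by
    intro x
    convert! (((hasDerivAt_id x).sub_const x₀).pow 2).const_mul (c / 4) using 1
    simp; ring
  have hgd : ∀ᶠ x in nhds x₀, HasDerivAt g (f' x - c / 2 * (x - x₀)) x :=
    hf.mono fun x hx => hx.sub (hsq x)
  have hgd' : deriv g =ᶠ[nhds x₀] fun x => f' x - c / 2 * (x - x₀) :=
    hgd.mono fun x hx => hx.deriv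
  have hdd : HasDerivAt (fun x => f' x - c / 2 * (x - x₀)) (c / 2) x₀ := by
    convert! hf'.sub (((hasDerivAt_id x₀).sub_const x₀).const_mul (c / 2)) using 1
    ring
  have hmin : IsLocalMin g x₀ := by
    refine isLocalMin_of_deriv_deriv_pos ?_ ?_ hgd.self_of_nhds.continuousAt
    · rw [hgd'.deriv_eq, hdd.deriv]; linarith
    · rw [hgd'.self_of_nhds]; simp [h0]
  filter_upwards [hmin.filter_mono nhdsWithin_le_nhds, self_mem_nhdsWithin] with x hx hne
  have hpos : 0 < (x - x₀) ^ 2 := by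
    have : x - x₀ ≠ 0 := sub_ne_zero.2 hne
    positivity
  simp only [hg, sub_self] at hx
  nlinarith [mul_pos hc hpos]

/-- The alternating charges `(-1)^{m+n}`. -/
def alternatingSign (x : ℤ × ℤ) : ℝ := (-1) ^ (x.1 + x.2)

lemma abs_alternatingSign_le (x : ℤ × ℤ) : |alternatingSign x| ≤ 1 := by
  simp [alternatingSign, abs_zpow]

lemma alternatingSign_swap (m n : ℤ) : alternatingSign (n, m) = alternatingSign (m, n) := by
  simp [alternatingSign, add_comm]

lemma S1_eq (p : ℝ) (hp : 1 < p) : S1 p = stretchedEnergyDeriv₂ (fun _ => 1) p 0 := by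
  rw [stretchedEnergyDeriv₂_zero, ← tsum_ne_zero_eq_tsum_hessianTerm (by simp) hp (by simp), S1]
  simp_rw [one_mul]

lemma S2_eq (q : ℝ) (hq : 1 < q) : S2 q = stretchedEnergyDeriv₂ alternatingSign q 0 := by
  rw [stretchedEnergyDeriv₂_zero,
    ← tsum_ne_zero_eq_tsum_hessianTerm abs_alternatingSign_le hq alternatingSign_swap]
  rfl

lemma S1_pos (p : ℝ) (hp : 1 < p) : 0 < S1 p := by
  rw [S1_eq p hp, stretchedEnergyDeriv₂_zero]
  simp_rw [one_mul]
  exact mul_pos (by linarith) (tsum_hessianTerm_pos p hp)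

lemma G_exp (p q V t : ℝ) (hp : 1 < p) (hq : 1 < q) (hV : 0 < V) :
    G p q V (Real.exp t) = V ^ (-p) * stretchedEnergy (fun _ => 1) p t +
      V ^ (-q) * stretchedEnergy alternatingSign q t := by
  rw [← tsum_ne_zero_eq_stretchedEnergy hp hV, ← tsum_ne_zero_eq_stretchedEnergy hq hV, G]
  simp_rw [one_mul]
  rfl

lemma hessian_pos (p q V : ℝ) (hq : 1 < q) (hpq : q < p) (hV0 : 0 < V)
    (hV : V < (S1 p / (-S2 q)) ^ ((1 : ℝ) / (p - q))) :
    0 < V ^ (-p) * S1 p + V ^ (-q) * S2 q := by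
  have h1 := S1_pos p (hq.trans hpq)
  have hVp := Real.rpow_pos_of_pos hV0 (-p)
  have hVq := Real.rpow_pos_of_pos hV0 (-q)
  rcases le_or_gt 0 (S2 q) with h2 | h2
  · exact add_pos_of_pos_of_nonneg (mul_pos hVp h1) (mul_nonneg hVq.le h2)
  · have hd : 0 < p - q := by linarith
    have h := Real.rpow_lt_rpow hV0.le hV hd
    rw [← Real.rpow_mul (div_nonneg h1.le (by linarith)), one_div_mul_cancel hd.ne',
      Real.rpow_one, lt_div_iff₀ (by linarith)] at h
    have e : V ^ (-q) = V ^ (-p) * V ^ (p - q) := by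
      rw [← Real.rpow_add hV0]; congr 1; ring
    rw [e]
    nlinarith [mul_lt_mul_of_pos_left h hVp]

/-- For `V < V_{p,q} = (S₁(p)/(-S₂(q)))^{1/(p-q)}`, `y = 1` is a strict local
minimum of `G_V` on `(0,∞)`. -/
theorem square_strict_local_min
    (p q V : ℝ) (hq : 1 < q) (hpq : q < p) (hV0 : 0 < V)
    (hV : V < (S1 p / (-S2 q)) ^ ((1 : ℝ) / (p - q))) :
    ∃ δ : ℝ, 0 < δ ∧ ∀ y : ℝ, 0 < y → |y - 1| < δ → y ≠ 1 →
      G p q V y > G p q V 1 := by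
  have hp := hq.trans hpq
  have hone : ∀ x : ℤ × ℤ, |(fun _ => (1 : ℝ)) x| ≤ 1 := by simp
  have zero_mem : (0 : ℝ) ∈ Set.Ioo (-1 : ℝ) 1 := by norm_num
  have hmin : ∀ᶠ t in nhdsWithin (0 : ℝ) {0}ᶜ,
      G p q V (Real.exp 0) < G p q V (Real.exp t) := by
    simp_rw [fun t => G_exp p q V t hp hq hV0]
    refine eventually_lt_of_deriv₂_pos
      (f := fun t => V ^ (-p) * stretchedEnergy (fun _ => 1) p t +
        V ^ (-q) * stretchedEnergy alternatingSign q t)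
      (f' := fun t => V ^ (-p) * stretchedEnergyDeriv (fun _ => 1) p t +
        V ^ (-q) * stretchedEnergyDeriv alternatingSign q t)
      ?_ (((hasDerivAt_stretchedEnergyDeriv hone hp zero_mem).const_mul _).add
        ((hasDerivAt_stretchedEnergyDeriv abs_alternatingSign_le hq zero_mem).const_mul _)) ?_ ?_
    · filter_upwards [isOpen_Ioo.mem_nhds zero_mem] with t ht
      exact ((hasDerivAt_stretchedEnergy hone hp ht).const_mul _).add
        ((hasDerivAt_stretchedEnergy abs_alternatingSign_le hq ht).const_mul _)
    · rw [stretchedEnergyDeriv_zero (fun _ _ => rfl),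
        stretchedEnergyDeriv_zero alternatingSign_swap, mul_zero, mul_zero, add_zero]
    · rw [← S1_eq p hp, ← S2_eq q hq]
      exact hessian_pos p q V hq hpq hV0 hV
  rw [eventually_nhdsWithin_iff] at hmin
  have hlog : Filter.Tendsto Real.log (nhds 1) (nhds 0) := by
    simpa using (Real.continuousAt_log one_ne_zero).tendsto
  obtain ⟨δ, hδ, h⟩ := Metric.eventually_nhds_iff.1 (hlog.eventually hmin)
  refine ⟨δ, hδ, fun y hy hyδ hy1 => ?_⟩
  have := h (by rwa [Real.dist_eq] : dist y 1 < δ) (Real.log_ne_zero_of_pos_of_ne_one hy hy1)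
  rwa [Real.exp_zero, Real.exp_log hy] at this
end
end

section
/- Let p > q > 1 and V > 0, and for y > 0 set G_V(y) = Σ_{(m,n)∈ℤ²∖{0}} (V(y²m² + y^{−2}n²))^{−p} + Σ_{(m,n)∈ℤ²∖{0}} (−1)^{m+n}(V(y²m² + y^{−2}n²))^{−q}. Then G_V is twice differentiable at y = 1, G_V'(1) = 0, and G_V''(1) = V^{−p}S₁(p) + V^{−q}S₂(q). -/
noncomputable section

/-- The quadratic form `y²m² + y⁻²n²` of the rectangular lattice `yℤ × y⁻¹ℤ`. -/
def rectForm (x : ℤ × ℤ) (y : ℝ) : ℝ :=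
  y ^ 2 * (x.1 : ℝ) ^ 2 + (y⁻¹) ^ 2 * (x.2 : ℝ) ^ 2

/-- The derivative of `rectForm x`. -/
def rectForm' (x : ℤ × ℤ) (y : ℝ) : ℝ :=
  2 * y * (x.1 : ℝ) ^ 2 - 2 * (y⁻¹) ^ 3 * (x.2 : ℝ) ^ 2

/-- The second derivative of `rectForm x`. -/
def rectForm'' (x : ℤ × ℤ) (y : ℝ) : ℝ :=
  2 * (x.1 : ℝ) ^ 2 + 6 * (y⁻¹) ^ 4 * (x.2 : ℝ) ^ 2

/-- The derivative of `rectForm x ^ (-s)`. -/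
def rectTerm' (s : ℝ) (x : ℤ × ℤ) (y : ℝ) : ℝ :=
  -s * (rectForm' x y * rectForm x y ^ (-s - 1))

/-- The second derivative of `rectForm x ^ (-s)`. -/
def rectTerm'' (s : ℝ) (x : ℤ × ℤ) (y : ℝ) : ℝ :=
  s * (s + 1) * (rectForm' x y ^ 2 * rectForm x y ^ (-s - 2))
    - s * (rectForm'' x y * rectForm x y ^ (-s - 1))

lemma sq_add_sq_pos {x : ℤ × ℤ} (hx : x ≠ 0) : 0 < (x.1 : ℝ) ^ 2 + (x.2 : ℝ) ^ 2 := by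
  rcases x with ⟨m, n⟩
  have h : m ≠ 0 ∨ n ≠ 0 := by
    by_contra! h
    exact hx (Prod.ext h.1 h.2)
  rcases h with h | h
  · have : (m : ℝ) ≠ 0 := by exact_mod_cast h
    positivity
  · have : (n : ℝ) ≠ 0 := by exact_mod_cast h
    positivity

lemma rectForm_nonneg (x : ℤ × ℤ) (y : ℝ) : 0 ≤ rectForm x y := by
  unfold rectForm
  positivity

lemma quarter_le_rectForm (x : ℤ × ℤ) {y : ℝ} (hy : y ∈ Set.Ioo (1 / 2 : ℝ) 2) :
    ((x.1 : ℝ) ^ 2 + (x.2 : ℝ) ^ 2) / 4 ≤ rectForm x y := by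
  obtain ⟨h1, h2⟩ := hy
  have hy2 : 1 / 4 ≤ y ^ 2 := by nlinarith
  have hinv : 1 / 2 ≤ y⁻¹ := by
    rw [← one_div]
    exact one_div_le_one_div_of_le (by linarith) h2.le
  have hi2 : 1 / 4 ≤ y⁻¹ ^ 2 := by nlinarith
  unfold rectForm
  nlinarith [mul_le_mul_of_nonneg_right hy2 (sq_nonneg (x.1 : ℝ)),
    mul_le_mul_of_nonneg_right hi2 (sq_nonneg (x.2 : ℝ))]

lemma rectForm_pos {x : ℤ × ℤ} (hx : x ≠ 0) {y : ℝ} (hy : y ∈ Set.Ioo (1 / 2 : ℝ) 2) :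
    0 < rectForm x y :=
  (div_pos (sq_add_sq_pos hx) four_pos).trans_le (quarter_le_rectForm x hy)

lemma abs_rectForm'_le (x : ℤ × ℤ) {y : ℝ} (hy : y ∈ Set.Ioo (1 / 2 : ℝ) 2) :
    |rectForm' x y| ≤ 4 * rectForm x y := by
  have hy0 : 0 < y := by linarith [hy.1]
  have hinv : y⁻¹ ≤ 2 := by
    rw [inv_le_comm₀ hy0 two_pos]
    linarith [hy.1]
  have key : rectForm' x y =
      2 * y⁻¹ * (y ^ 2 * (x.1 : ℝ) ^ 2 - y⁻¹ ^ 2 * (x.2 : ℝ) ^ 2) := by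
    unfold rectForm'
    field_simp
  have ha : 0 ≤ y ^ 2 * (x.1 : ℝ) ^ 2 := by positivity
  have hb : 0 ≤ y⁻¹ ^ 2 * (x.2 : ℝ) ^ 2 := by positivity
  rw [key, abs_mul, abs_of_pos (by positivity)]
  exact mul_le_mul (by linarith) (by unfold rectForm; rw [abs_le]; constructor <;> linarith)
    (abs_nonneg _) (by norm_num)

lemma abs_rectForm''_le (x : ℤ × ℤ) {y : ℝ} (hy : y ∈ Set.Ioo (1 / 2 : ℝ) 2) :
    |rectForm'' x y| ≤ 24 * rectForm x y := by
  have hy0 : 0 < y := by linarith [hy.1]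
  have hi0 : 0 < y⁻¹ := by positivity
  have hinv : y⁻¹ ≤ 2 := by
    rw [inv_le_comm₀ hy0 two_pos]
    linarith [hy.1]
  have key : rectForm'' x y =
      y⁻¹ ^ 2 * (2 * (y ^ 2 * (x.1 : ℝ) ^ 2) + 6 * (y⁻¹ ^ 2 * (x.2 : ℝ) ^ 2)) := by
    unfold rectForm''
    field_simp
  have ha : 0 ≤ y ^ 2 * (x.1 : ℝ) ^ 2 := by positivity
  have hb : 0 ≤ y⁻¹ ^ 2 * (x.2 : ℝ) ^ 2 := by positivity
  rw [key, abs_of_nonneg (by positivity)]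
  calc _ ≤ 4 * (6 * rectForm x y) :=
        mul_le_mul (by nlinarith) (by unfold rectForm; linarith) (by positivity) (by norm_num)
    _ = _ := by ring

lemma hasDerivAt_rectForm (x : ℤ × ℤ) {y : ℝ} (hy : y ≠ 0) :
    HasDerivAt (rectForm x) (rectForm' x y) y := by
  have h := ((hasDerivAt_pow 2 y).mul_const ((x.1 : ℝ) ^ 2)).add
    (((hasDerivAt_inv hy).pow 2).mul_const ((x.2 : ℝ) ^ 2))
  refine h.congr_deriv ?_
  unfold rectForm'
  push_cast
  ring

lemma hasDerivAt_rectForm' (x : ℤ × ℤ) {y : ℝ} (hy : y ≠ 0) :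
    HasDerivAt (rectForm' x) (rectForm'' x y) y := by
  have h := (((hasDerivAt_id y).const_mul 2).mul_const ((x.1 : ℝ) ^ 2)).sub
    ((((hasDerivAt_inv hy).pow 3).const_mul 2).mul_const ((x.2 : ℝ) ^ 2))
  refine h.congr_deriv ?_
  unfold rectForm''
  push_cast
  ring

lemma hasDerivAt_rectForm_rpow (s : ℝ) {x : ℤ × ℤ} (hx : x ≠ 0) {y : ℝ}
    (hy : y ∈ Set.Ioo (1 / 2 : ℝ) 2) :
    HasDerivAt (fun y => rectForm x y ^ (-s)) (rectTerm' s x y) y := by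
  have hy0 : y ≠ 0 := by linarith [hy.1]
  refine ((hasDerivAt_rectForm x hy0).rpow_const (Or.inl (rectForm_pos hx hy).ne')).congr_deriv ?_
  unfold rectTerm'
  ring

lemma hasDerivAt_rectTerm' (s : ℝ) {x : ℤ × ℤ} (hx : x ≠ 0) {y : ℝ}
    (hy : y ∈ Set.Ioo (1 / 2 : ℝ) 2) :
    HasDerivAt (rectTerm' s x) (rectTerm'' s x y) y := by
  have hy0 : y ≠ 0 := by linarith [hy.1]
  refine (((hasDerivAt_rectForm' x hy0).mul ((hasDerivAt_rectForm x hy0).rpow_const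
    (p := -s - 1) (Or.inl (rectForm_pos hx hy).ne'))).const_mul (-s)).congr_deriv ?_
  unfold rectTerm''
  rw [show -s - 1 - 1 = -s - 2 by ring]
  ring

lemma mul_rectForm_rpow (s : ℝ) {x : ℤ × ℤ} (hx : x ≠ 0) {y : ℝ}
    (hy : y ∈ Set.Ioo (1 / 2 : ℝ) 2) :
    rectForm x y * rectForm x y ^ (-s - 1) = rectForm x y ^ (-s) := by
  have h := rectForm_pos hx hy
  rw [Real.rpow_sub_one h.ne']
  field_simp

lemma sq_mul_rectForm_rpow (s : ℝ) {x : ℤ × ℤ} (hx : x ≠ 0) {y : ℝ}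
    (hy : y ∈ Set.Ioo (1 / 2 : ℝ) 2) :
    rectForm x y ^ 2 * rectForm x y ^ (-s - 2) = rectForm x y ^ (-s) := by
  have h := rectForm_pos hx hy
  rw [Real.rpow_sub h, Real.rpow_two]
  field_simp

lemma rectForm_rpow_le {s : ℝ} (hs : 0 < s) {x : ℤ × ℤ} (hx : x ≠ 0) {y : ℝ}
    (hy : y ∈ Set.Ioo (1 / 2 : ℝ) 2) :
    rectForm x y ^ (-s) ≤ (((x.1 : ℝ) ^ 2 + (x.2 : ℝ) ^ 2) / 4) ^ (-s) :=
  Real.rpow_le_rpow_of_nonpos (div_pos (sq_add_sq_pos hx) four_pos)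
    (quarter_le_rectForm x hy) (by linarith)

lemma abs_rectTerm'_le {s : ℝ} (hs : 0 < s) {x : ℤ × ℤ} (hx : x ≠ 0) {y : ℝ}
    (hy : y ∈ Set.Ioo (1 / 2 : ℝ) 2) :
    |rectTerm' s x y| ≤ 4 * s * (((x.1 : ℝ) ^ 2 + (x.2 : ℝ) ^ 2) / 4) ^ (-s) := by
  have h := rectForm_pos hx hy
  calc |rectTerm' s x y| = s * (|rectForm' x y| * rectForm x y ^ (-s - 1)) := by
        rw [rectTerm', abs_mul, abs_mul, abs_neg, abs_of_pos hs,
          abs_of_pos (Real.rpow_pos_of_pos h _)]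
    _ ≤ s * (4 * rectForm x y * rectForm x y ^ (-s - 1)) := by
        gcongr
        exact abs_rectForm'_le x hy
    _ = 4 * s * rectForm x y ^ (-s) := by
        rw [← mul_rectForm_rpow s hx hy]
        ring
    _ ≤ _ := by
        gcongr ?_ * ?_
        exact rectForm_rpow_le hs hx hy

lemma abs_rectTerm''_le {s : ℝ} (hs : 0 < s) {x : ℤ × ℤ} (hx : x ≠ 0) {y : ℝ}
    (hy : y ∈ Set.Ioo (1 / 2 : ℝ) 2) :
    |rectTerm'' s x y| ≤
      (16 * s * (s + 1) + 24 * s) * (((x.1 : ℝ) ^ 2 + (x.2 : ℝ) ^ 2) / 4) ^ (-s) := by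
  have h := rectForm_pos hx hy
  have hsq : rectForm' x y ^ 2 ≤ 16 * rectForm x y ^ 2 := by
    have := sq_le_sq' (by linarith [abs_nonneg (rectForm' x y)]) (abs_rectForm'_le x hy)
    rw [sq_abs] at this
    linarith
  calc |rectTerm'' s x y|
      ≤ s * (s + 1) * (rectForm' x y ^ 2 * rectForm x y ^ (-s - 2))
        + s * (|rectForm'' x y| * rectForm x y ^ (-s - 1)) := by
        refine (abs_sub _ _).trans_eq ?_
        rw [abs_of_nonneg (by positivity), abs_mul s, abs_mul, abs_of_pos hs,
          abs_of_pos (Real.rpow_pos_of_pos h _)]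
    _ ≤ s * (s + 1) * (16 * rectForm x y ^ 2 * rectForm x y ^ (-s - 2))
        + s * (24 * rectForm x y * rectForm x y ^ (-s - 1)) := by
        gcongr
        exact abs_rectForm''_le x hy
    _ = (16 * s * (s + 1) + 24 * s) * rectForm x y ^ (-s) := by
        linear_combination 16 * s * (s + 1) * sq_mul_rectForm_rpow s hx hy
          + 24 * s * mul_rectForm_rpow s hx hy
    _ ≤ _ := by
        gcongr ?_ * ?_
        exact rectForm_rpow_le hs hx hy

lemma summable_sq_add_sq_rpow {s : ℝ} (hs : 1 < s) :
    Summable fun x : {x : ℤ × ℤ // x ≠ 0} =>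
      (((x.1.1 : ℝ) ^ 2 + (x.1.2 : ℝ) ^ 2) / 4) ^ (-s) := by
  have h0 := EisensteinSeries.summable_one_div_norm_rpow (k := 2 * s) (by linarith)
  have h1 : Summable fun x : {x : ℤ × ℤ // x ≠ 0} =>
      (4 : ℝ) ^ s * ‖(![x.1.1, x.1.2] : Fin 2 → ℤ)‖ ^ (-(2 * s)) :=
    ((h0.comp_injective (finTwoArrowEquiv ℤ).symm.injective).comp_injective
      Subtype.val_injective).mul_left _
  refine Summable.of_nonneg_of_le (fun x => by positivity) (fun x => ?_) h1
  have hN := sq_add_sq_pos x.2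
  have hpos : 0 < ‖(![x.1.1, x.1.2] : Fin 2 → ℤ)‖ :=
    norm_pos_iff.2 fun h => x.2 (Prod.ext (congrFun h 0) (congrFun h 1))
  have hle : ‖(![x.1.1, x.1.2] : Fin 2 → ℤ)‖ ^ 2 ≤ (x.1.1 : ℝ) ^ 2 + (x.1.2 : ℝ) ^ 2 := by
    have : ‖(![x.1.1, x.1.2] : Fin 2 → ℤ)‖ ≤ √((x.1.1 : ℝ) ^ 2 + (x.1.2 : ℝ) ^ 2) := by
      refine (pi_norm_le_iff_of_nonneg (Real.sqrt_nonneg _)).2 fun i => ?_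
      fin_cases i
      · exact Real.abs_le_sqrt (by simpa using sq_nonneg (x.1.2 : ℝ))
      · exact Real.abs_le_sqrt (by simpa using sq_nonneg (x.1.1 : ℝ))
    exact (Real.le_sqrt' hpos).1 this
  rw [Real.div_rpow hN.le (by norm_num), Real.rpow_neg (by norm_num : (0 : ℝ) ≤ 4),
    div_inv_eq_mul, mul_comm]
  gcongr ?_ * ?_
  rw [show -(2 * s) = 2 * -s by ring, Real.rpow_mul hpos.le, Real.rpow_two]
  exact Real.rpow_le_rpow_of_nonpos (by positivity) hle (by linarith)

/-- The energy `Σ ε(m,n) (y²m² + y⁻²n²)^{-s}` of the rectangular lattice with charges `ε`. -/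
def rectEnergy (ε : ℤ × ℤ → ℝ) (s y : ℝ) : ℝ :=
  ∑' x : {x : ℤ × ℤ // x ≠ 0}, ε x.1 * rectForm x.1 y ^ (-s)

/-- The termwise derivative of `rectEnergy ε s`. -/
def rectEnergy' (ε : ℤ × ℤ → ℝ) (s y : ℝ) : ℝ :=
  ∑' x : {x : ℤ × ℤ // x ≠ 0}, ε x.1 * rectTerm' s x.1 y

section Charges

variable {ε : ℤ × ℤ → ℝ} {s : ℝ}

lemma norm_charge_mul_le (hε : ∀ x, |ε x| ≤ 1) (x : ℤ × ℤ) {a b : ℝ} (h : |a| ≤ b) :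
    ‖ε x * a‖ ≤ b := by
  rw [norm_mul]
  exact (mul_le_of_le_one_left (abs_nonneg a) (hε x)).trans h

lemma summable_charge_mul_rectTerm' (hε : ∀ x, |ε x| ≤ 1) (hs : 1 < s) {y : ℝ}
    (hy : y ∈ Set.Ioo (1 / 2 : ℝ) 2) :
    Summable fun x : {x : ℤ × ℤ // x ≠ 0} => ε x.1 * rectTerm' s x.1 y :=
  .of_norm_bounded ((summable_sq_add_sq_rpow hs).mul_left (4 * s)) fun x =>
    norm_charge_mul_le hε x.1 (abs_rectTerm'_le (by linarith) x.2 hy)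

lemma summable_charge_mul_rectTerm'' (hε : ∀ x, |ε x| ≤ 1) (hs : 1 < s) {y : ℝ}
    (hy : y ∈ Set.Ioo (1 / 2 : ℝ) 2) :
    Summable fun x : {x : ℤ × ℤ // x ≠ 0} => ε x.1 * rectTerm'' s x.1 y :=
  .of_norm_bounded ((summable_sq_add_sq_rpow hs).mul_left _) fun x =>
    norm_charge_mul_le hε x.1 (abs_rectTerm''_le (by linarith) x.2 hy)

lemma hasDerivAt_rectEnergy (hε : ∀ x, |ε x| ≤ 1) (hs : 1 < s) {y : ℝ}
    (hy : y ∈ Set.Ioo (1 / 2 : ℝ) 2) :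
    HasDerivAt (rectEnergy ε s) (rectEnergy' ε s y) y :=
  hasDerivAt_tsum_of_isPreconnected ((summable_sq_add_sq_rpow hs).mul_left (4 * s))
    isOpen_Ioo isPreconnected_Ioo
    (fun x _ hz => (hasDerivAt_rectForm_rpow s x.2 hz).const_mul (ε x.1))
    (fun x _ hz => norm_charge_mul_le hε x.1 (abs_rectTerm'_le (by linarith) x.2 hz)) hy
    (.of_norm_bounded (summable_sq_add_sq_rpow hs) fun x => norm_charge_mul_le hε x.1 <| by
      rw [abs_of_nonneg (Real.rpow_nonneg (rectForm_nonneg _ _) _)]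
      exact rectForm_rpow_le (by linarith) x.2 hy) hy

lemma hasDerivAt_rectEnergy' (hε : ∀ x, |ε x| ≤ 1) (hs : 1 < s) {y : ℝ}
    (hy : y ∈ Set.Ioo (1 / 2 : ℝ) 2) :
    HasDerivAt (rectEnergy' ε s)
      (∑' x : {x : ℤ × ℤ // x ≠ 0}, ε x.1 * rectTerm'' s x.1 y) y :=
  hasDerivAt_tsum_of_isPreconnected
    ((summable_sq_add_sq_rpow hs).mul_left (16 * s * (s + 1) + 24 * s))
    isOpen_Ioo isPreconnected_Ioo
    (fun x _ hz => (hasDerivAt_rectTerm' s x.2 hz).const_mul (ε x.1))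
    (fun x _ hz => norm_charge_mul_le hε x.1 (abs_rectTerm''_le (by linarith) x.2 hz)) hy
    (summable_charge_mul_rectTerm' hε hs hy) hy

/-- The square lattice is a critical point, by the symmetry `(m,n) ↦ (n,m)`. -/
lemma rectEnergy'_one (hswap : ∀ x, ε x.swap = ε x) : rectEnergy' ε s 1 = 0 := by
  let e : {x : ℤ × ℤ // x ≠ 0} ≃ {x : ℤ × ℤ // x ≠ 0} :=
    (Equiv.prodComm ℤ ℤ).subtypeEquiv fun x => by simp [Prod.ext_iff, and_comm]
  have h : rectEnergy' ε s 1 = -rectEnergy' ε s 1 := by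
    conv_lhs => rw [rectEnergy', ← e.tsum_eq]
    rw [rectEnergy', ← tsum_neg]
    refine tsum_congr fun x => ?_
    have he : (e x).1 = x.1.swap := rfl
    rw [he, hswap]
    simp only [rectTerm', rectForm', rectForm, Prod.fst_swap, Prod.snd_swap]
    rw [add_comm]
    norm_num
    ring
  linarith

lemma tsum_charge_mul_rectTerm''_one (hε : ∀ x, |ε x| ≤ 1) (hswap : ∀ x, ε x.swap = ε x)
    (hs : 1 < s) :
    ∑' x : {x : ℤ × ℤ // x ≠ 0}, ε x.1 * rectTerm'' s x.1 1 =
      4 * s * ∑' x : {x : ℤ × ℤ // x ≠ 0}, ε x.1 *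
        ((s + 1) * ((x.1.2 : ℝ) ^ 2 - (x.1.1 : ℝ) ^ 2) ^ 2
          - 2 * (x.1.1 : ℝ) ^ 4 - 2 * (x.1.1 : ℝ) ^ 2 * (x.1.2 : ℝ) ^ 2)
        / ((x.1.1 : ℝ) ^ 2 + (x.1.2 : ℝ) ^ 2) ^ (s + 2) := by
  have h1 : (1 : ℝ) ∈ Set.Ioo (1 / 2 : ℝ) 2 := by norm_num
  have h0 : ∑' x : {x : ℤ × ℤ // x ≠ 0}, ε x.1 * rectTerm' s x.1 1 = 0 := rectEnergy'_one hswap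
  have hadd := (summable_charge_mul_rectTerm'' hε hs h1).tsum_add
    ((summable_charge_mul_rectTerm' hε hs h1).mul_left 3)
  rw [tsum_mul_left, h0, mul_zero, add_zero] at hadd
  rw [← hadd, ← tsum_mul_left]
  refine tsum_congr fun x => ?_
  have hN := sq_add_sq_pos x.2
  have hQ : rectForm x.1 1 = (x.1.1 : ℝ) ^ 2 + (x.1.2 : ℝ) ^ 2 := by simp [rectForm]
  have hpow : ((x.1.1 : ℝ) ^ 2 + (x.1.2 : ℝ) ^ 2) ^ (-s - 1)
      = ((x.1.1 : ℝ) ^ 2 + (x.1.2 : ℝ) ^ 2)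
        * ((x.1.1 : ℝ) ^ 2 + (x.1.2 : ℝ) ^ 2) ^ (-s - 2) := by
    rw [show -s - 1 = 1 + (-s - 2) by ring, Real.rpow_add hN, Real.rpow_one]
  rw [div_eq_mul_inv, ← Real.rpow_neg hN.le, neg_add']
  simp only [rectTerm'', rectTerm', hQ, rectForm', rectForm'', hpow]
  norm_num
  ring

end Charges

lemma abs_neg_one_zpow_le (x : ℤ × ℤ) : |(-1 : ℝ) ^ (x.1 + x.2)| ≤ 1 := by
  rw [abs_zpow]
  simp

lemma G_eq_rectEnergy (p q : ℝ) {V : ℝ} (hV : 0 ≤ V) (y : ℝ) :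
    G p q V y = V ^ (-p) * rectEnergy (fun _ => 1) p y
      + V ^ (-q) * rectEnergy (fun x => (-1 : ℝ) ^ (x.1 + x.2)) q y := by
  simp only [rectEnergy, ← tsum_mul_left]
  unfold G
  congr 1 <;> refine tsum_congr fun x => ?_ <;>
    rw [← rectForm, Real.mul_rpow hV (rectForm_nonneg _ _)] <;> ring

/-- `G_V` is twice differentiable at `y = 1` with `G_V'(1) = 0` and
`G_V''(1) = V^{-p}S₁(p) + V^{-q}S₂(q)`. -/
theorem second_derivative_at_square
    (p q V : ℝ) (hq : 1 < q) (hpq : q < p) (hV0 : 0 < V) :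
    HasDerivAt (fun y : ℝ => G p q V y) 0 1 ∧
    HasDerivAt (deriv (fun y : ℝ => G p q V y))
      (V ^ (-p) * S1 p + V ^ (-q) * S2 q) 1 := by
  have h1 : (1 : ℝ) ∈ Set.Ioo (1 / 2 : ℝ) 2 := by norm_num
  have hp : 1 < p := hq.trans hpq
  have hone : ∀ x : ℤ × ℤ, |(fun _ : ℤ × ℤ => (1 : ℝ)) x| ≤ 1 := by simp
  have hswap : ∀ x : ℤ × ℤ, (-1 : ℝ) ^ (x.swap.1 + x.swap.2) = (-1 : ℝ) ^ (x.1 + x.2) :=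
    fun x => by rw [Prod.fst_swap, Prod.snd_swap, add_comm]
  simp only [G_eq_rectEnergy p q hV0.le]
  have hd : ∀ y ∈ Set.Ioo (1 / 2 : ℝ) 2, HasDerivAt
      (fun y => V ^ (-p) * rectEnergy (fun _ => 1) p y
        + V ^ (-q) * rectEnergy (fun x => (-1 : ℝ) ^ (x.1 + x.2)) q y)
      (V ^ (-p) * rectEnergy' (fun _ => 1) p y
        + V ^ (-q) * rectEnergy' (fun x => (-1 : ℝ) ^ (x.1 + x.2)) q y) y := fun y hy =>
    ((hasDerivAt_rectEnergy hone hp hy).const_mul _).add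
      ((hasDerivAt_rectEnergy abs_neg_one_zpow_le hq hy).const_mul _)
  constructor
  · refine (hd 1 h1).congr_deriv ?_
    rw [rectEnergy'_one fun _ => rfl, rectEnergy'_one hswap]
    ring
  · have hev : deriv (fun y => V ^ (-p) * rectEnergy (fun _ => 1) p y
        + V ^ (-q) * rectEnergy (fun x => (-1 : ℝ) ^ (x.1 + x.2)) q y) =ᶠ[nhds 1]
        fun y => V ^ (-p) * rectEnergy' (fun _ => 1) p y
          + V ^ (-q) * rectEnergy' (fun x => (-1 : ℝ) ^ (x.1 + x.2)) q y :=
      Filter.eventuallyEq_of_mem (isOpen_Ioo.mem_nhds h1) fun y hy => (hd y hy).deriv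
    refine HasDerivAt.congr_of_eventuallyEq ?_ hev
    refine (((hasDerivAt_rectEnergy' hone hp h1).const_mul _).add
      ((hasDerivAt_rectEnergy' abs_neg_one_zpow_le hq h1).const_mul _)).congr_deriv ?_
    rw [tsum_charge_mul_rectTerm''_one hone (fun _ => rfl) hp,
      tsum_charge_mul_rectTerm''_one abs_neg_one_zpow_le hswap hq]
    simp only [S1, S2, one_mul]
end
end
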